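/- arXiv:1007.1366 — 6 statements merged into one kernel-verified Lean document; each statement's English description precedes it below -/
import Mathlib

section
/- Let n ≥ 2 and let U be a random matrix distributed according to the Haar probability measure on the unitary group U(n). Then for any fixed indices i, j ∈ {1,…,n}, the law of the random variable |U_{ij}|² is the Beta distribution with parameters (1, n−1), i.e. the pushforward of the Haar measure under U ↦ |U_{ij}|² is the measure on [0,1] with density x ↦ (n−1)(1−x)^{n−2} with respect to Lebesgue measure. -/
open MeasureTheory Matrix

/-- The entrywise (Borel) measurable structure on matrices. -/
instance matrixMeasurableSpace {m n α : Type*} [MeasurableSpace α] :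
    MeasurableSpace (Matrix m n α) :=
  inferInstanceAs (MeasurableSpace (m → n → α))


lemma lint_radial (b s : ℝ) (hb : 0 < b) (hs : 0 ≤ s) :
    ∫⁻ r in Set.Ioi (0:ℝ), ENNReal.ofReal r *
      Set.indicator {r : ℝ | s < r ^ 2} (fun r => ENNReal.ofReal (Real.exp (-b * r ^ 2))) r
      = ENNReal.ofReal (Real.exp (-b * s) / (2 * b)) := by
  have h1 : ∀ r ∈ Set.Ioi (0:ℝ), ENNReal.ofReal r *
      Set.indicator {r : ℝ | s < r ^ 2} (fun r => ENNReal.ofReal (Real.exp (-b * r ^ 2))) r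
      = Set.indicator (Set.Ioi (Real.sqrt s))
          (fun r => ENNReal.ofReal (r * Real.exp (-b * r ^ 2))) r := by
    intro r hr
    have hr' : 0 < r := hr
    by_cases h : s < r ^ 2
    · have h2 : r ∈ Set.Ioi (Real.sqrt s) := (Real.sqrt_lt' hr').2 h
      rw [Set.indicator_of_mem h2, Set.indicator_of_mem (show r ∈ {r : ℝ | s < r ^ 2} from h),
        ENNReal.ofReal_mul hr'.le]
    · have h2 : r ∉ Set.Ioi (Real.sqrt s) := fun h' => h ((Real.sqrt_lt' hr').1 h')
      rw [Set.indicator_of_notMem h2, Set.indicator_of_notMem (show r ∉ {r : ℝ | s < r ^ 2} from h),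
        mul_zero]
  rw [setLIntegral_congr_fun measurableSet_Ioi h1,
    setLIntegral_indicator measurableSet_Ioi,
    Set.inter_eq_left.2 (Set.Ioi_subset_Ioi (Real.sqrt_nonneg s))]
  have hd : ∀ x ∈ Set.Ici (Real.sqrt s), HasDerivAt (fun r => -Real.exp (-b * r ^ 2) / (2 * b))
      (x * Real.exp (-b * x ^ 2)) x := by
    intro x _
    have := ((((hasDerivAt_pow 2 x).const_mul (-b)).exp).neg).div_const (2 * b)
    refine this.congr_deriv ?_
    rw [div_eq_iff (by positivity)]
    push_cast
    ring
  have hnn : ∀ x ∈ Set.Ioi (Real.sqrt s), 0 ≤ x * Real.exp (-b * x ^ 2) := by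
    intro x hx
    have : 0 ≤ x := (Real.sqrt_nonneg s).trans (le_of_lt hx)
    positivity
  have ht : Filter.Tendsto (fun r : ℝ => -Real.exp (-b * r ^ 2) / (2 * b)) Filter.atTop (nhds 0) := by
    have h3 : Filter.Tendsto (fun r : ℝ => -b * r ^ 2) Filter.atTop Filter.atBot :=
      (Filter.tendsto_pow_atTop two_ne_zero).const_mul_atTop_of_neg (by linarith)
    have := ((Real.tendsto_exp_atBot.comp h3).neg).div_const (2 * b)
    simpa using this
  have hi := integrableOn_Ioi_deriv_of_nonneg' hd hnn ht
  rw [← ofReal_integral_eq_lintegral_ofReal hi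
    ((ae_restrict_iff' measurableSet_Ioi).2 (Filter.Eventually.of_forall hnn)),
    integral_Ioi_of_hasDerivAt_of_nonneg' hd hnn ht, Real.sq_sqrt hs]
  congr 1
  ring

lemma lint_gauss_tail (b s : ℝ) (hb : 0 < b) (hs : 0 ≤ s) :
    ∫⁻ z : ℂ, Set.indicator {z : ℂ | s < ‖z‖ ^ 2}
      (fun z => ENNReal.ofReal (Real.exp (-b * ‖z‖ ^ 2))) z
      = ENNReal.ofReal (Real.pi / b * Real.exp (-b * s)) := by
  rw [← Complex.lintegral_comp_polarCoord_symm, polarCoord_target, Measure.volume_eq_prod,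
    ← Measure.prod_restrict]
  have : ∀ p : ℝ × ℝ, ENNReal.ofReal p.1 • Set.indicator {z : ℂ | s < ‖z‖ ^ 2}
      (fun z => ENNReal.ofReal (Real.exp (-b * ‖z‖ ^ 2))) (Complex.polarCoord.symm p)
      = (ENNReal.ofReal p.1 * Set.indicator {r : ℝ | s < r ^ 2}
        (fun r => ENNReal.ofReal (Real.exp (-b * r ^ 2))) p.1) * (fun _ : ℝ => 1) p.2 := by
    intro p
    simp [Set.indicator_apply]
  rw [lintegral_congr this, lintegral_prod_mul (f := fun r => ENNReal.ofReal r * Set.indicator {r : ℝ | s < r ^ 2}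
        (fun r => ENNReal.ofReal (Real.exp (-b * r ^ 2))) r) (g := fun _ : ℝ => 1), lint_radial b s hb hs]
  · simp only [lintegral_const, Measure.restrict_apply_univ, Real.volume_Ioo, one_mul]
    rw [← ENNReal.ofReal_mul (by positivity)]
    congr 1
    field_simp
    ring
  · refine (Measurable.mul (by fun_prop) (Measurable.indicator (by fun_prop) ?_)).aemeasurable
    exact measurableSet_lt (by fun_prop) (by fun_prop)
  · fun_prop

lemma lint_gauss (b : ℝ) (hb : 0 < b) :
    ∫⁻ z : ℂ, ENNReal.ofReal (Real.exp (-b * ‖z‖ ^ 2)) = ENNReal.ofReal (Real.pi / b) := by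
  have := lint_gauss_tail b 0 hb le_rfl
  simp only [mul_zero, Real.exp_zero, mul_one] at this
  rw [← this]
  refine lintegral_congr_ae ?_
  filter_upwards [compl_mem_ae_iff.2 (measure_singleton (0:ℂ))] with z hz
  have hz : z ≠ 0 := hz
  rw [Set.indicator_of_mem]
  show 0 < ‖z‖ ^ 2
  positivity

lemma lint_split (m : ℕ) (j : Fin (m + 1)) (F : ℂ → (Fin m → ℂ) → ENNReal)
    (hF : Measurable (Function.uncurry F)) :
    ∫⁻ x : Fin (m + 1) → ℂ, F (x j) (fun k => x (j.succAbove k)) = ∫⁻ y, ∫⁻ z, F z y := by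
  have h := (volume_preserving_piFinSuccAbove (fun _ : Fin (m + 1) => ℂ) j).lintegral_comp hF
  rw [Measure.volume_eq_prod, lintegral_prod_symm _ hF.aemeasurable] at h
  exact h

lemma lint_gauss_pi (b : ℝ) (hb : 0 < b) (m : ℕ) :
    ∫⁻ y : Fin m → ℂ, ENNReal.ofReal (Real.exp (-b * ∑ k, ‖y k‖ ^ 2))
      = ENNReal.ofReal ((Real.pi / b) ^ m) := by
  induction m with
  | zero => simp [Measure.volume_pi_eq_dirac (0 : Fin 0 → ℂ)]
  | succ m ih =>
    have := lint_split m 0 (fun z y => ENNReal.ofReal (Real.exp (-b * ‖z‖ ^ 2)) *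
      ENNReal.ofReal (Real.exp (-b * ∑ k, ‖y k‖ ^ 2))) (by fun_prop)
    simp_rw [Fin.sum_univ_succ, mul_add, Real.exp_add, ENNReal.ofReal_mul (Real.exp_nonneg _)]
    simp only [Fin.succAbove_zero] at this
    rw [this]
    simp_rw [lintegral_mul_const' _ _ ENNReal.ofReal_ne_top, lint_gauss b hb]
    rw [lintegral_const_mul' _ _ ENNReal.ofReal_ne_top, ih, ← ENNReal.ofReal_mul (by positivity),
      pow_succ']

lemma lint_ratio (m : ℕ) (j : Fin (m + 1)) (t : ℝ) (h0 : 0 ≤ t) (h1 : t < 1) :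
    ∫⁻ x : Fin (m + 1) → ℂ, Set.indicator {x | t * ∑ k, ‖x k‖ ^ 2 < ‖x j‖ ^ 2}
      (fun x => ENNReal.ofReal (Real.exp (-∑ k, ‖x k‖ ^ 2))) x
      = ENNReal.ofReal (Real.pi ^ (m + 1) * (1 - t) ^ m) := by
  have ht : 0 < 1 - t := by linarith
  have key := lint_split m j (fun z y => Set.indicator
      {p : ℂ × (Fin m → ℂ) | t / (1 - t) * ∑ k, ‖p.2 k‖ ^ 2 < ‖p.1‖ ^ 2}
      (fun p => ENNReal.ofReal (Real.exp (-1 * ‖p.1‖ ^ 2)) *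
        ENNReal.ofReal (Real.exp (-1 * ∑ k, ‖p.2 k‖ ^ 2))) (z, y)) (by
      refine Measurable.indicator (by fun_prop) ?_
      exact measurableSet_lt (by fun_prop) (by fun_prop))
  have e1 : ∀ x : Fin (m + 1) → ℂ, Set.indicator {x | t * ∑ k, ‖x k‖ ^ 2 < ‖x j‖ ^ 2}
      (fun x : Fin (m + 1) → ℂ => ENNReal.ofReal (Real.exp (-∑ k, ‖x k‖ ^ 2))) x =
      Set.indicator
      {p : ℂ × (Fin m → ℂ) | t / (1 - t) * ∑ k, ‖p.2 k‖ ^ 2 < ‖p.1‖ ^ 2}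
      (fun p => ENNReal.ofReal (Real.exp (-1 * ‖p.1‖ ^ 2)) *
        ENNReal.ofReal (Real.exp (-1 * ∑ k, ‖p.2 k‖ ^ 2))) (x j, fun k => x (j.succAbove k)) := by
    intro x
    simp only [Set.indicator_apply, Set.mem_ofPred_eq]
    simp only [Fin.sum_univ_succAbove _ j]
    rw [← ENNReal.ofReal_mul (Real.exp_nonneg _), ← Real.exp_add]
    congr 1
    · rw [div_mul_eq_mul_div, div_lt_iff₀ ht, eq_iff_iff]
      constructor <;> intro h <;> linarith
    · congr 2
      ring
  simp_rw [e1]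
  rw [key]
  have e2 : ∀ y : Fin m → ℂ, ∫⁻ z : ℂ, Set.indicator
      {p : ℂ × (Fin m → ℂ) | t / (1 - t) * ∑ k, ‖p.2 k‖ ^ 2 < ‖p.1‖ ^ 2}
      (fun p => ENNReal.ofReal (Real.exp (-1 * ‖p.1‖ ^ 2)) *
        ENNReal.ofReal (Real.exp (-1 * ∑ k, ‖p.2 k‖ ^ 2))) (z, y)
      = ENNReal.ofReal Real.pi * ENNReal.ofReal (Real.exp (-(1 / (1 - t)) * ∑ k, ‖y k‖ ^ 2)) := by
    intro y
    have hS : 0 ≤ ∑ k, ‖y k‖ ^ 2 := by positivity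
    have e3 := lint_gauss_tail 1 (t / (1 - t) * ∑ k, ‖y k‖ ^ 2) one_pos (by positivity)
    have e4 : ∀ z : ℂ, Set.indicator
      {p : ℂ × (Fin m → ℂ) | t / (1 - t) * ∑ k, ‖p.2 k‖ ^ 2 < ‖p.1‖ ^ 2}
      (fun p => ENNReal.ofReal (Real.exp (-1 * ‖p.1‖ ^ 2)) *
        ENNReal.ofReal (Real.exp (-1 * ∑ k, ‖p.2 k‖ ^ 2))) (z, y) =
        Set.indicator {z : ℂ | t / (1 - t) * ∑ k, ‖y k‖ ^ 2 < ‖z‖ ^ 2}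
      (fun z => ENNReal.ofReal (Real.exp (-1 * ‖z‖ ^ 2))) z *
        ENNReal.ofReal (Real.exp (-1 * ∑ k, ‖y k‖ ^ 2)) := by
      intro z
      simp only [Set.indicator_apply, Set.mem_ofPred_eq, ite_mul, zero_mul]
    simp_rw [e4]
    rw [lintegral_mul_const' _ _ ENNReal.ofReal_ne_top, e3, ← ENNReal.ofReal_mul (by positivity),
      ← ENNReal.ofReal_mul (by positivity), mul_assoc, ← Real.exp_add]
    congr 2
    · simp
    · congr 1
      field_simp
      ring
  simp_rw [e2]
  rw [lintegral_const_mul' _ _ ENNReal.ofReal_ne_top, lint_gauss_pi _ (by positivity),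
    ← ENNReal.ofReal_mul (by positivity)]
  congr 1
  rw [div_div_eq_mul_div, div_one, mul_pow]
  ring

lemma sum_norm_sq_unitary {n : ℕ} (V : Matrix (Fin n) (Fin n) ℂ) (hV : Vᴴ * V = 1)
    (x : Fin n → ℂ) : ∑ k, ‖(V *ᵥ x) k‖ ^ 2 = ∑ k, ‖x k‖ ^ 2 := by
  have h : ∀ y : Fin n → ℂ, ((∑ k, ‖y k‖ ^ 2 : ℝ) : ℂ) = star y ⬝ᵥ y := by
    intro y
    push_cast
    simp only [dotProduct, Pi.star_apply, RCLike.star_def, Complex.conj_mul']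
  have : ((∑ k, ‖(V *ᵥ x) k‖ ^ 2 : ℝ) : ℂ) = ((∑ k, ‖x k‖ ^ 2 : ℝ) : ℂ) := by
    rw [h, h, star_mulVec, dotProduct_mulVec, vecMul_vecMul, hV, vecMul_one]
  exact_mod_cast this

lemma measurePreserving_unitary {n : ℕ} (V : Matrix (Fin n) (Fin n) ℂ)
    (hV : V ∈ Matrix.unitaryGroup (Fin n) ℂ) :
    MeasurePreserving (fun x : Fin n → ℂ => V *ᵥ x) volume volume := by
  have hd : ‖V.det‖ = 1 := by
    have := (Matrix.det_of_mem_unitary hV).2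
    rw [RCLike.star_def, Complex.mul_conj'] at this
    norm_cast at this
    rwa [pow_eq_one_iff_of_nonneg (norm_nonneg _) two_ne_zero] at this
  have hdet : LinearMap.det ((Matrix.toLin' V).restrictScalars ℝ) = 1 := by
    rw [LinearMap.det_restrictScalars, LinearMap.det_toLin', Algebra.norm_complex_apply,
      Complex.normSq_eq_norm_sq, hd, one_pow]
  have h := Measure.map_linearMap_addHaar_eq_smul_addHaar (volume : Measure (Fin n → ℂ))
    (f := (Matrix.toLin' V).restrictScalars ℝ) (by rw [hdet]; exact one_ne_zero)
  rw [hdet] at h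
  simp only [inv_one, abs_one, ENNReal.ofReal_one, one_smul] at h
  refine ⟨?_, h⟩
  refine measurable_pi_lambda _ fun k => ?_
  simp only [mulVec, dotProduct]
  fun_prop

lemma exists_unitary_col {n : ℕ} (i : Fin n) (x : Fin n → ℂ) (hx : x ≠ 0) :
    ∃ W ∈ Matrix.unitaryGroup (Fin n) ℂ,
      ∀ k, x k = (Real.sqrt (∑ l, ‖x l‖ ^ 2) : ℂ) * W k i := by
  let u : EuclideanSpace ℂ (Fin n) := WithLp.toLp 2 x
  have hu : u ≠ 0 := by
    intro h
    apply hx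
    funext k
    exact congrArg (fun v : EuclideanSpace ℂ (Fin n) => v k) h
  have hun : ‖u‖ = Real.sqrt (∑ l, ‖x l‖ ^ 2) := EuclideanSpace.norm_eq u
  have hn0 : (‖u‖ : ℂ) ≠ 0 := by exact_mod_cast norm_ne_zero_iff.2 hu
  let v : Fin n → EuclideanSpace ℂ (Fin n) := fun _ => (‖u‖ : ℂ)⁻¹ • u
  have hv : Orthonormal ℂ (({i} : Set (Fin n)).domRestrict v) := by
    constructor
    · intro k
      simp [v, norm_smul, hu]
    · intro k l hkl
      exact absurd (Subsingleton.elim k l) hkl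
  obtain ⟨b, hb⟩ := hv.exists_orthonormalBasis_extension_of_card_eq (by simp)
  refine ⟨_, (EuclideanSpace.basisFun (Fin n) ℂ).toMatrix_orthonormalBasis_mem_unitary b, ?_⟩
  intro k
  rw [← hun]
  simp only [Module.Basis.toMatrix_apply, hb i rfl, v]
  simp
  field_simp
  rfl

lemma measurable_entry {n : ℕ} (i j : Fin n) :
    Measurable (fun U : Matrix.unitaryGroup (Fin n) ℂ => (U : Matrix (Fin n) (Fin n) ℂ) i j) := by
  have : Measurable (fun M : Matrix (Fin n) (Fin n) ℂ => M i j) :=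
    (measurable_pi_apply j).comp (measurable_pi_apply (X := fun _ => Fin n → ℂ) i)
  exact this.comp measurable_subtype_coe

lemma measurable_left_mul {n : ℕ} (V : Matrix.unitaryGroup (Fin n) ℂ) :
    Measurable (fun U : Matrix.unitaryGroup (Fin n) ℂ => V * U) := by
  refine Measurable.subtype_mk ?_
  refine measurable_pi_lambda _ fun k => measurable_pi_lambda _ fun l => ?_
  have : ∀ U : Matrix.unitaryGroup (Fin n) ℂ, ((V : Matrix (Fin n) (Fin n) ℂ) * U) k l =
    ∑ p, (V : Matrix (Fin n) (Fin n) ℂ) k p * (U : Matrix (Fin n) (Fin n) ℂ) p l :=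
    fun U => Matrix.mul_apply
  change Measurable fun U : Matrix.unitaryGroup (Fin n) ℂ =>
    ((V : Matrix (Fin n) (Fin n) ℂ) * (U : Matrix (Fin n) (Fin n) ℂ)) k l
  simp_rw [this]
  exact Finset.measurable_sum _ fun p _ => (measurable_entry p l).const_mul _

lemma haar_side {n : ℕ} (μ : Measure (Matrix.unitaryGroup (Fin n) ℂ))
    [μ.IsMulLeftInvariant] (i j : Fin n) (t : ℝ) (x : Fin n → ℂ) (hx : x ≠ 0) :
    μ {U | t * ∑ k, ‖x k‖ ^ 2 < ‖((U : Matrix (Fin n) (Fin n) ℂ)ᴴ *ᵥ x) j‖ ^ 2}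
      = μ {U | t < ‖(U : Matrix (Fin n) (Fin n) ℂ) i j‖ ^ 2} := by
  obtain ⟨W, hW, hxW⟩ := exists_unitary_col i x hx
  have hS : 0 < ∑ k, ‖x k‖ ^ 2 := by
    obtain ⟨k, hk⟩ := Function.ne_iff.1 hx
    exact Finset.sum_pos' (fun _ _ => by positivity)
      ⟨k, Finset.mem_univ _, by have : x k ≠ 0 := hk; positivity⟩
  set S := ∑ k, ‖x k‖ ^ 2 with hSdef
  let V : Matrix.unitaryGroup (Fin n) ℂ := ⟨W, hW⟩
  have hm : MeasurableSet {U : Matrix.unitaryGroup (Fin n) ℂ |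
      t < ‖(U : Matrix (Fin n) (Fin n) ℂ) i j‖ ^ 2} :=
    measurableSet_lt measurable_const ((measurable_entry i j).norm.pow_const 2)
  have hinv : (μ.map (fun U => V⁻¹ * U)) {U : Matrix.unitaryGroup (Fin n) ℂ |
      t < ‖(U : Matrix (Fin n) (Fin n) ℂ) i j‖ ^ 2} = μ {U : Matrix.unitaryGroup (Fin n) ℂ |
      t < ‖(U : Matrix (Fin n) (Fin n) ℂ) i j‖ ^ 2} := by
    rw [map_mul_left_eq_self μ (V⁻¹)]
  rw [Measure.map_apply (measurable_left_mul _) hm] at hinv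
  rw [← hinv]
  congr 1
  ext U
  have h1 : ((U : Matrix (Fin n) (Fin n) ℂ)ᴴ *ᵥ x) j
      = (Real.sqrt S : ℂ) * star (((V⁻¹ * U : Matrix.unitaryGroup (Fin n) ℂ) :
        Matrix (Fin n) (Fin n) ℂ) i j) := by
    have : ((V⁻¹ * U : Matrix.unitaryGroup (Fin n) ℂ) : Matrix (Fin n) (Fin n) ℂ) i j
        = ∑ k, star (W k i) * (U : Matrix (Fin n) (Fin n) ℂ) k j := by
      change (star W * (U : Matrix (Fin n) (Fin n) ℂ)) i j = _
      rw [Matrix.mul_apply]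
      rfl
    rw [this, star_sum, Finset.mul_sum]
    simp only [mulVec, dotProduct, conjTranspose_apply]
    refine Finset.sum_congr rfl fun k _ => ?_
    rw [hxW k, star_mul', star_star]
    ring
  have h2 : ‖((U : Matrix (Fin n) (Fin n) ℂ)ᴴ *ᵥ x) j‖ ^ 2 = S *
      ‖((V⁻¹ * U : Matrix.unitaryGroup (Fin n) ℂ) : Matrix (Fin n) (Fin n) ℂ) i j‖ ^ 2 := by
    rw [h1, norm_mul, norm_star, mul_pow, Complex.norm_real, Real.norm_eq_abs, sq_abs,
      Real.sq_sqrt hS.le]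
  change t * S < _ ↔ t < _
  rw [h2, mul_comm t S, mul_lt_mul_iff_right₀ hS]


lemma entry_tail {m : ℕ} (μ : Measure (Matrix.unitaryGroup (Fin (m + 1)) ℂ))
    [μ.IsMulLeftInvariant] [IsProbabilityMeasure μ] (i j : Fin (m + 1)) (t : ℝ)
    (h0 : 0 ≤ t) (h1 : t < 1) :
    μ {U | t < ‖(U : Matrix (Fin (m + 1)) (Fin (m + 1)) ℂ) i j‖ ^ 2}
      = ENNReal.ofReal ((1 - t) ^ m) := by
  let g : (Fin (m + 1) → ℂ) → ENNReal := fun x => ENNReal.ofReal (Real.exp (-∑ k, ‖x k‖ ^ 2))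
  have hg : Measurable g := by fun_prop
  let A : Set ((Fin (m + 1) → ℂ) × Matrix.unitaryGroup (Fin (m + 1)) ℂ) :=
    {p | t * ∑ k, ‖p.1 k‖ ^ 2 < ‖((p.2 : Matrix (Fin (m + 1)) (Fin (m + 1)) ℂ)ᴴ *ᵥ p.1) j‖ ^ 2}
  have hA : MeasurableSet A := by
    refine measurableSet_lt (by fun_prop) ?_
    refine (Measurable.norm ?_).pow_const 2
    simp only [mulVec, dotProduct, conjTranspose_apply]
    refine Finset.measurable_sum _ fun k _ => ?_
    refine Measurable.mul ?_ (by fun_prop)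
    exact (continuous_star.measurable).comp ((measurable_entry k j).comp measurable_snd)
  let F : (Fin (m + 1) → ℂ) → Matrix.unitaryGroup (Fin (m + 1)) ℂ → ENNReal :=
    fun x U => A.indicator (fun p => g p.1) (x, U)
  have hF : Measurable (Function.uncurry F) :=
    Measurable.indicator (hg.comp measurable_fst) hA
  have hswap := lintegral_lintegral_swap (μ := (volume : Measure (Fin (m + 1) → ℂ))) (ν := μ)
    hF.aemeasurable
  have hL : ∀ᵐ x : Fin (m + 1) → ℂ, ∫⁻ U, F x U ∂μ =
      g x * μ {U | t < ‖(U : Matrix (Fin (m + 1)) (Fin (m + 1)) ℂ) i j‖ ^ 2} := by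
    filter_upwards [compl_mem_ae_iff.2 (measure_singleton (0 : Fin (m + 1) → ℂ))] with x hx
    rw [← haar_side μ i j t x hx]
    exact lintegral_indicator_const (μ := μ) (measurable_prodMk_left (x := x) hA) (g x)
  have hR : ∀ U, ∫⁻ x, F x U = ENNReal.ofReal (Real.pi ^ (m + 1) * (1 - t) ^ m) := by
    intro U
    have hU : (U : Matrix (Fin (m + 1)) (Fin (m + 1)) ℂ)ᴴ ∈ Matrix.unitaryGroup (Fin (m + 1)) ℂ :=
      (star U).2
    have hU' : (U : Matrix (Fin (m + 1)) (Fin (m + 1)) ℂ)ᴴᴴ *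
      (U : Matrix (Fin (m + 1)) (Fin (m + 1)) ℂ)ᴴ = 1 := by
      rw [conjTranspose_conjTranspose]; exact U.2.2
    rw [← lint_ratio m j t h0 h1, ← (measurePreserving_unitary _ hU).lintegral_comp
      (f := fun x => Set.indicator {x : Fin (m + 1) → ℂ | t * ∑ k, ‖x k‖ ^ 2 < ‖x j‖ ^ 2}
      (fun x => ENNReal.ofReal (Real.exp (-∑ k, ‖x k‖ ^ 2))) x)]
    · refine lintegral_congr fun x => ?_
      simp only [F, A, g, Set.indicator_apply, Set.mem_ofPred_eq, sum_norm_sq_unitary _ hU' x]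
    · refine Measurable.indicator (by fun_prop) ?_
      exact measurableSet_lt (by fun_prop) (by fun_prop)
  have hg1 : ∫⁻ x, g x = ENNReal.ofReal (Real.pi ^ (m + 1)) := by
    have := lint_gauss_pi 1 one_pos (m + 1)
    simpa [g] using this
  rw [lintegral_congr_ae hL, lintegral_mul_const _ hg, hg1] at hswap
  simp_rw [hR] at hswap
  rw [lintegral_const, measure_univ, mul_one, ENNReal.ofReal_mul (by positivity)] at hswap
  exact (ENNReal.mul_right_inj (by simp; positivity) ENNReal.ofReal_ne_top).1 hswap

lemma beta_Iic (m : ℕ) (hm : 1 ≤ m) (t : ℝ) (h0 : 0 ≤ t) (h1 : t ≤ 1) :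
    (volume.withDensity (fun x => ENNReal.ofReal
        (Set.indicator (Set.Icc (0 : ℝ) 1)
          (fun x => (((m + 1 : ℕ) : ℝ) - 1) * (1 - x) ^ (m + 1 - 2)) x))) (Set.Iic t)
      = ENNReal.ofReal (1 - (1 - t) ^ m) := by
  obtain ⟨l, rfl⟩ : ∃ l, m = l + 1 := ⟨m - 1, by omega⟩
  rw [withDensity_apply _ measurableSet_Iic]
  have e : ∀ x : ℝ, ENNReal.ofReal
        (Set.indicator (Set.Icc (0 : ℝ) 1)
          (fun x => (((l + 1 + 1 : ℕ) : ℝ) - 1) * (1 - x) ^ (l + 1 + 1 - 2)) x) =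
        Set.indicator (Set.Icc (0 : ℝ) 1)
          (fun x => ENNReal.ofReal (((l : ℝ) + 1) * (1 - x) ^ l)) x := by
    intro x
    have : l + 1 + 1 - 2 = l := by omega
    rw [this]
    by_cases hx : x ∈ Set.Icc (0 : ℝ) 1
    · rw [Set.indicator_of_mem hx, Set.indicator_of_mem hx]
      push_cast
      congr 2
      ring
    · rw [Set.indicator_of_notMem hx, Set.indicator_of_notMem hx, ENNReal.ofReal_zero]
  simp_rw [e]
  have hset : Set.Icc (0 : ℝ) 1 ∩ Set.Iic t = Set.Icc 0 t := by
    ext x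
    simp only [Set.mem_inter_iff, Set.mem_Icc, Set.mem_Iic]
    constructor
    · rintro ⟨⟨a, b⟩, c⟩; exact ⟨a, c⟩
    · rintro ⟨a, c⟩; exact ⟨⟨a, c.trans h1⟩, c⟩
  rw [setLIntegral_indicator measurableSet_Icc, hset]
  have hd : ∀ x ∈ Set.uIcc 0 t, HasDerivAt (fun x : ℝ => -(1 - x) ^ (l + 1))
      (((l : ℝ) + 1) * (1 - x) ^ l) x := by
    intro x _
    refine (((hasDerivAt_id x).const_sub 1).pow (l + 1)).neg.congr_deriv ?_
    simp
  have hc : Continuous fun x : ℝ => ((l : ℝ) + 1) * (1 - x) ^ l := by fun_prop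
  rw [← ofReal_integral_eq_lintegral_ofReal (hc.continuousOn.integrableOn_Icc),
    integral_Icc_eq_integral_Ioc, ← intervalIntegral.integral_of_le h0,
    intervalIntegral.integral_eq_sub_of_hasDerivAt hd (hc.intervalIntegrable _ _)]
  · congr 1
    simp
    ring
  · refine (ae_restrict_iff' measurableSet_Icc).2 (Filter.Eventually.of_forall fun x hx => ?_)
    have : 0 ≤ 1 - x := by linarith [hx.2]
    show 0 ≤ ((l : ℝ) + 1) * (1 - x) ^ l
    positivity

/-- If `U` is Haar distributed on the unitary group `U(n)` with `n ≥ 2`, then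
for any indices `i, j`, the law of `|U_{ij}|²` is the Beta distribution with parameters
`(1, n-1)`, i.e. the measure on `[0,1]` with density `x ↦ (n-1)(1-x)^(n-2)` w.r.t. Lebesgue. -/
theorem law_abs_sq_entry_unitary_is_beta (n : ℕ) (hn : 2 ≤ n)
    (μ : Measure (Matrix.unitaryGroup (Fin n) ℂ))
    [μ.IsHaarMeasure] [IsProbabilityMeasure μ] (i j : Fin n) :
    μ.map (fun U : Matrix.unitaryGroup (Fin n) ℂ => ‖(U : Matrix (Fin n) (Fin n) ℂ) i j‖ ^ 2) =
      volume.withDensity (fun x => ENNReal.ofReal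
        (Set.indicator (Set.Icc (0 : ℝ) 1)
          (fun x => ((n : ℝ) - 1) * (1 - x) ^ (n - 2)) x)) := by
  obtain ⟨m, rfl⟩ : ∃ m, n = m + 1 := ⟨n - 1, by omega⟩
  have hm : 1 ≤ m := by omega
  have hmeas : Measurable (fun U : Matrix.unitaryGroup (Fin (m + 1)) ℂ =>
      ‖(U : Matrix (Fin (m + 1)) (Fin (m + 1)) ℂ) i j‖ ^ 2) :=
    (measurable_entry i j).norm.pow_const 2
  have : IsProbabilityMeasure (μ.map (fun U : Matrix.unitaryGroup (Fin (m + 1)) ℂ =>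
      ‖(U : Matrix (Fin (m + 1)) (Fin (m + 1)) ℂ) i j‖ ^ 2)) :=
    Measure.isProbabilityMeasure_map hmeas.aemeasurable
  refine Measure.ext_of_Iic _ _ fun t => ?_
  rw [Measure.map_apply hmeas measurableSet_Iic]
  rcases lt_or_ge t 0 with ht | ht
  · have e1 : (fun U : Matrix.unitaryGroup (Fin (m + 1)) ℂ =>
      ‖(U : Matrix (Fin (m + 1)) (Fin (m + 1)) ℂ) i j‖ ^ 2) ⁻¹' Set.Iic t = ∅ := by
      ext U
      simp only [Set.mem_preimage, Set.mem_Iic, Set.mem_empty_iff_false, iff_false, not_le]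
      exact lt_of_lt_of_le ht (by positivity)
    rw [e1, measure_empty]
    symm
    refine measure_mono_null (Set.Iic_subset_Iic.2 ht.le) ?_
    rw [beta_Iic m hm 0 le_rfl zero_le_one]
    simp
  rcases lt_or_ge t 1 with ht1 | ht1
  · rw [beta_Iic m hm t ht ht1.le]
    have e1 : (fun U : Matrix.unitaryGroup (Fin (m + 1)) ℂ =>
      ‖(U : Matrix (Fin (m + 1)) (Fin (m + 1)) ℂ) i j‖ ^ 2) ⁻¹' Set.Iic t =
        {U : Matrix.unitaryGroup (Fin (m + 1)) ℂ |
          t < ‖(U : Matrix (Fin (m + 1)) (Fin (m + 1)) ℂ) i j‖ ^ 2}ᶜ := by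
      ext U
      simp
    rw [e1, prob_compl_eq_one_sub (measurableSet_lt measurable_const hmeas),
      entry_tail μ i j t ht ht1, ENNReal.ofReal_sub _ (by have : 0 ≤ 1 - t := by linarith
                                                          positivity), ENNReal.ofReal_one]
  · have e1 : (fun U : Matrix.unitaryGroup (Fin (m + 1)) ℂ =>
      ‖(U : Matrix (Fin (m + 1)) (Fin (m + 1)) ℂ) i j‖ ^ 2) ⁻¹' Set.Iic t = Set.univ := by
      ext U
      simp only [Set.mem_preimage, Set.mem_Iic, Set.mem_univ, iff_true]
      have := entry_norm_bound_of_unitary U.2 i j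
      exact (pow_le_one₀ (norm_nonneg _) this).trans ht1
    rw [e1, measure_univ]
    have e2 := beta_Iic m hm 1 zero_le_one le_rfl
    rw [sub_self, zero_pow (by omega), sub_zero, ENNReal.ofReal_one] at e2
    rw [← e2, ← Set.Iic_union_Ioc_eq_Iic ht1]
    symm
    rw [measure_union (Set.Iic_disjoint_Ioc le_rfl) measurableSet_Ioc,
      withDensity_apply _ measurableSet_Ioc, setLIntegral_eq_zero measurableSet_Ioc, add_zero]
    intro x hx
    have : x ∉ Set.Icc (0 : ℝ) 1 := fun h => absurd h.2 (not_le.2 hx.1)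
    simp [this]
end

section
/- Let n ≥ 1 and let U be a random matrix distributed according to the Haar probability measure on the unitary group U(n). Then for any fixed indices i, j ∈ {1,…,n} and any integer k ≥ 1, E[|U_{ij}|^{2k}] = (n−1)! k! / (n−1+k)!. -/
open MeasureTheory Matrix

namespace HaarMoment

/-- Extracting the first order coefficient of a polynomial identity under a linear functional. -/
theorem core {A : Type*} [CommRing A] [Algebra ℂ A] (L : A →ₗ[ℂ] ℂ) (x y x' y' : A) (k : ℕ)
    (h : ∀ t : ℝ, L ((x + (t : ℂ) • y) ^ k * (x' + (t : ℂ) • y') ^ (k + 1) *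
      (y - (t : ℂ) • x)) = 0)
    (hmid : L (x ^ (k - 1) * x' ^ (k + 1) * y ^ 2) = 0) :
    L ((x * x') ^ (k + 1)) = (k + 1) * L ((x * x') ^ k * (y * y')) := by
  classical
  set P : Polynomial A := (Polynomial.C x + Polynomial.X * Polynomial.C y) ^ k *
    (Polynomial.C x' + Polynomial.X * Polynomial.C y') ^ (k + 1) *
      (Polynomial.C y - Polynomial.X * Polynomial.C x) with hP
  set Q : Polynomial ℂ := ∑ e ∈ P.support, Polynomial.monomial e (L (P.coeff e)) with hQ
  have hQe : ∀ t : ℂ, Q.eval t = L (P.eval (algebraMap ℂ A t)) := by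
    intro t
    rw [Polynomial.eval_eq_sum (p := P), Polynomial.sum, map_sum, hQ, Polynomial.eval_finsetSum]
    refine Finset.sum_congr rfl fun e _ => ?_
    rw [Polynomial.eval_monomial, ← map_pow, mul_comm (P.coeff e), ← Algebra.smul_def, map_smul,
      smul_eq_mul, mul_comm]
  have hQ0 : Q = 0 := by
    apply Polynomial.eq_zero_of_infinite_isRoot
    refine Set.Infinite.mono (s := Set.range (fun t : ℝ => (t : ℂ))) ?_
      (Set.infinite_range_of_injective Complex.ofReal_injective)
    rintro _ ⟨t, rfl⟩
    show Q.eval (t : ℂ) = 0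
    rw [hQe, ← h t]
    have hcm : ∀ z : A, z * algebraMap ℂ A t = algebraMap ℂ A t * z := fun z => mul_comm _ _
    simp [hP, Algebra.smul_def, hcm]
  have h1 : L (P.coeff 1) = 0 := by
    have : Q.coeff 1 = L (P.coeff 1) := by
      rw [hQ, Polynomial.finsetSum_coeff]
      simp only [Polynomial.coeff_monomial]
      rw [Finset.sum_ite_eq']
      split_ifs with hh
      · rfl
      · rw [Polynomial.notMem_support_iff.mp hh, map_zero]
    rw [← this, hQ0, Polynomial.coeff_zero]
  have h2 : P.coeff 1 = (P.derivative).eval 0 := by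
    rw [← Polynomial.coeff_zero_eq_eval_zero, Polynomial.coeff_derivative]; simp
  have h3 : P.coeff 1 = (k : ℂ) • (x ^ (k - 1) * x' ^ (k + 1) * y ^ 2)
      + ((k : ℂ) + 1) • ((x * x') ^ k * (y * y')) - (x * x') ^ (k + 1) := by
    rw [h2, hP]
    simp [Polynomial.derivative_mul, Polynomial.derivative_pow, Algebra.smul_def]
    ring
  rw [h3, map_sub, map_add, map_smul, map_smul, hmid] at h1
  simp only [smul_eq_mul, mul_zero, zero_add] at h1
  linear_combination -h1

variable {n : ℕ}

instance instBorelMatrix : BorelSpace (Matrix (Fin n) (Fin n) ℂ) :=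
  inferInstanceAs (BorelSpace (Fin n → Fin n → ℂ))

instance instBorelUnitary : BorelSpace (Matrix.unitaryGroup (Fin n) ℂ) := Subtype.borelSpace _

instance instCompactUnitary : CompactSpace (Matrix.unitaryGroup (Fin n) ℂ) := by
  apply isCompact_iff_compactSpace.mp
  have hc : IsClosed ((Matrix.unitaryGroup (Fin n) ℂ : Set (Matrix (Fin n) (Fin n) ℂ))) := by
    have : (Matrix.unitaryGroup (Fin n) ℂ : Set (Matrix (Fin n) (Fin n) ℂ))
        = {A | A * star A = 1} := by
      ext A; exact Matrix.mem_unitaryGroup_iff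
    rw [this]
    exact isClosed_eq (by fun_prop) continuous_const
  have hK : IsCompact (Set.pi Set.univ fun _ : Fin n => Set.pi Set.univ fun _ : Fin n =>
      Metric.closedBall (0 : ℂ) 1) :=
    isCompact_univ_pi fun _ => isCompact_univ_pi fun _ => isCompact_closedBall _ _
  refine IsCompact.of_isClosed_subset hK hc ?_
  intro A hA a _ b _
  simpa using entry_norm_bound_of_unitary hA a b

/-- Integration as a linear functional on continuous functions. -/
noncomputable def intL (μ : Measure (Matrix.unitaryGroup (Fin n) ℂ)) [IsProbabilityMeasure μ] :
    C(Matrix.unitaryGroup (Fin n) ℂ, ℂ) →ₗ[ℂ] ℂ where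
  toFun f := ∫ U, f U ∂μ
  map_add' f g := integral_add
    (f.continuous.integrable_of_hasCompactSupport (HasCompactSupport.of_compactSpace _))
    (g.continuous.integrable_of_hasCompactSupport (HasCompactSupport.of_compactSpace _))
  map_smul' c f := integral_smul c _

/-- Entry functions. -/
def ent (l j : Fin n) : C(Matrix.unitaryGroup (Fin n) ℂ, ℂ) where
  toFun U := (U : Matrix (Fin n) (Fin n) ℂ) l j
  continuous_toFun := by
    exact (continuous_apply_apply l j).comp continuous_subtype_val

theorem exists_rot (i m : Fin n) (him : i ≠ m) (c s : ℝ) (hcs : c ^ 2 + s ^ 2 = 1) :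
    ∃ V : Matrix.unitaryGroup (Fin n) ℂ, ∀ (U : Matrix.unitaryGroup (Fin n) ℂ) (j : Fin n),
      ((V * U : Matrix.unitaryGroup (Fin n) ℂ) : Matrix (Fin n) (Fin n) ℂ) i j =
        c * (U : Matrix (Fin n) (Fin n) ℂ) i j + s * (U : Matrix (Fin n) (Fin n) ℂ) m j ∧
      ((V * U : Matrix.unitaryGroup (Fin n) ℂ) : Matrix (Fin n) (Fin n) ℂ) m j =
        c * (U : Matrix (Fin n) (Fin n) ℂ) m j - s * (U : Matrix (Fin n) (Fin n) ℂ) i j := by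
  have hcs' : (c : ℂ) ^ 2 + (s : ℂ) ^ 2 = 1 := by exact_mod_cast hcs
  set P : Matrix (Fin n) (Fin n) ℂ := single i i 1 + single m m 1 with hP
  set J : Matrix (Fin n) (Fin n) ℂ := single i m 1 - single m i 1 with hJ
  have hPP : P * P = P := by
    simp [hP, add_mul, mul_add, him, him.symm]
  have hPJ : P * J = J := by
    simp [hP, hJ, add_mul, mul_sub, him, him.symm, ← sub_eq_add_neg]
  have hJP : J * P = J := by
    simp [hP, hJ, sub_mul, mul_add, him, him.symm]; abel
  have hJJ : J * J = -P := by
    simp [hP, hJ, sub_mul, mul_sub, him, him.symm]; abel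
  have hPs : star P = P := by
    simp [hP, star_eq_conjTranspose]
  have hJs : star J = -J := by
    simp [hJ, star_eq_conjTranspose]
  have hV : (1 + ((c : ℂ) - 1) • P + (s : ℂ) • J) ∈ Matrix.unitaryGroup (Fin n) ℂ := by
    rw [Matrix.mem_unitaryGroup_iff]
    simp only [star_add, star_smul, star_one, hPs, hJs, star_sub, RCLike.star_def,
      Complex.conj_ofReal]
    simp only [add_mul, mul_add, one_mul, mul_one, smul_mul_assoc, mul_smul_comm, mul_neg, smul_neg,
      hPP, hPJ, hJP, hJJ]
    have : ((c : ℂ) - 1) • P + ((c : ℂ) - 1) • P + ((c : ℂ) - 1) • ((c : ℂ) - 1) • P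
        + (s : ℂ) • (s : ℂ) • P = 0 := by
      simp only [smul_smul, ← add_smul]
      rw [show ((c : ℂ) - 1) + ((c : ℂ) - 1) + ((c : ℂ) - 1) * ((c : ℂ) - 1) + (s : ℂ) * s = 0 by
        linear_combination hcs', zero_smul]
    refine Eq.trans ?_ ((congrArg (fun Z => (1 : Matrix (Fin n) (Fin n) ℂ) + Z) this).trans (add_zero _))
    module
  refine ⟨⟨_, hV⟩, fun U j => ?_⟩
  constructor
  · simp [hP, hJ, add_mul, sub_mul, him, him.symm]
  · simp [hP, hJ, add_mul, sub_mul, him, him.symm]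
    ring

theorem exists_phase (i m : Fin n) (him : i ≠ m) (w : ℂ) (hw : w * star w = 1) :
    ∃ V : Matrix.unitaryGroup (Fin n) ℂ, ∀ (U : Matrix.unitaryGroup (Fin n) ℂ) (j : Fin n),
      ((V * U : Matrix.unitaryGroup (Fin n) ℂ) : Matrix (Fin n) (Fin n) ℂ) i j =
        (U : Matrix (Fin n) (Fin n) ℂ) i j ∧
      ((V * U : Matrix.unitaryGroup (Fin n) ℂ) : Matrix (Fin n) (Fin n) ℂ) m j =
        w * (U : Matrix (Fin n) (Fin n) ℂ) m j := by
  have hV : (diagonal (Function.update 1 m w)) ∈ Matrix.unitaryGroup (Fin n) ℂ := by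
    rw [Matrix.mem_unitaryGroup_iff, star_eq_conjTranspose, diagonal_conjTranspose,
      diagonal_mul_diagonal, ← diagonal_one]
    congr 1
    ext l
    by_cases hl : l = m
    · subst hl; simpa using hw
    · simp [hl]
  refine ⟨⟨_, hV⟩, fun U j => ?_⟩
  constructor <;> simp [him]

section
variable (μ : Measure (Matrix.unitaryGroup (Fin n) ℂ)) [μ.IsHaarMeasure] [IsProbabilityMeasure μ]

theorem step (i m j : Fin n) (him : i ≠ m) (k : ℕ) :
    intL μ ((ent i j * star (ent i j)) ^ (k + 1)) =
      (k + 1) * intL μ ((ent i j * star (ent i j)) ^ k * (ent m j * star (ent m j))) := by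
  apply core
  · intro t
    have hF0 : ∫ U : Matrix.unitaryGroup (Fin n) ℂ, (U.1 i j) ^ k * (star (U.1 i j)) ^ (k + 1) *
        U.1 m j ∂μ = 0 := by
      obtain ⟨V, hV⟩ := exists_phase i m him (-1) (by simp)
      have := integral_mul_left_eq_self (μ := μ) (fun U : Matrix.unitaryGroup (Fin n) ℂ =>
        (U.1 i j) ^ k * (star (U.1 i j)) ^ (k + 1) * U.1 m j) V
      simp only [hV, neg_mul, one_mul, mul_neg, integral_neg] at this
      linear_combination (-1/2 : ℂ) * this
    have hpos : 0 < 1 + t ^ 2 := by positivity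
    set c : ℝ := (Real.sqrt (1 + t ^ 2))⁻¹ with hc
    have hc0 : c ≠ 0 := by positivity
    have hcs : c ^ 2 + (c * t) ^ 2 = 1 := by
      rw [hc, mul_pow, inv_pow, Real.sq_sqrt hpos.le]; field_simp
    obtain ⟨V, hV⟩ := exists_rot i m him c (c * t) hcs
    have := integral_mul_left_eq_self (μ := μ) (fun U : Matrix.unitaryGroup (Fin n) ℂ =>
        (U.1 i j) ^ k * (star (U.1 i j)) ^ (k + 1) * U.1 m j) V
    rw [hF0] at this
    have h2 : (c : ℂ) ^ (2 * k + 2) * ∫ U : Matrix.unitaryGroup (Fin n) ℂ,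
        (U.1 i j + t * U.1 m j) ^ k * (star (U.1 i j) + t * star (U.1 m j)) ^ (k + 1) *
          (U.1 m j - t * U.1 i j) ∂μ = 0 := by
      rw [← this, ← integral_const_mul]
      congr 1
      ext U
      rw [(hV U j).1, (hV U j).2]
      have e1 : (c : ℂ) * U.1 i j + ((c * t : ℝ) : ℂ) * U.1 m j
          = c * (U.1 i j + t * U.1 m j) := by push_cast; ring
      have e2 : (c : ℂ) * U.1 m j - ((c * t : ℝ) : ℂ) * U.1 i j
          = c * (U.1 m j - t * U.1 i j) := by push_cast; ring
      have e3 : star ((c : ℂ) * (U.1 i j + t * U.1 m j))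
          = c * (star (U.1 i j) + t * star (U.1 m j)) := by simp
      rw [e1, e2, e3, mul_pow, mul_pow]
      ring
    have hcc : (c : ℂ) ^ (2 * k + 2) ≠ 0 := pow_ne_zero _ (by exact_mod_cast hc0)
    exact (mul_eq_zero.mp h2).resolve_left hcc
  · obtain ⟨V, hV⟩ := exists_phase i m him Complex.I (by simp)
    have := integral_mul_left_eq_self (μ := μ) (fun U : Matrix.unitaryGroup (Fin n) ℂ =>
      (U.1 i j) ^ (k - 1) * (star (U.1 i j)) ^ (k + 1) * U.1 m j ^ 2) V
    simp only [hV, mul_pow, Complex.I_sq, neg_mul, one_mul, mul_neg, integral_neg] at this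
    change ∫ U : Matrix.unitaryGroup (Fin n) ℂ,
      (U.1 i j) ^ (k - 1) * (star (U.1 i j)) ^ (k + 1) * U.1 m j ^ 2 ∂μ = 0
    linear_combination (-1/2 : ℂ) * this

theorem sum_ent (j : Fin n) : ∑ l, ent l j * star (ent l j) = 1 := by
  ext U
  have h := Matrix.mem_unitaryGroup_iff'.mp U.2
  have h' := congrFun (congrFun h j) j
  rw [Matrix.mul_apply] at h'
  simp only [one_apply_eq] at h'
  simp only [ContinuousMap.coe_sum, Finset.sum_apply, ContinuousMap.one_apply]
  rw [← h']
  refine Finset.sum_congr rfl fun l _ => ?_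
  exact mul_comm _ _

theorem recur (i j : Fin n) (k : ℕ) :
    ((k : ℂ) + n) * intL μ ((ent i j * star (ent i j)) ^ (k + 1)) =
      (k + 1) * intL μ ((ent i j * star (ent i j)) ^ k) := by
  have hn : 1 ≤ n := Nat.one_le_of_lt i.2
  have h1 : intL μ ((ent i j * star (ent i j)) ^ k) =
      ∑ l, intL μ ((ent i j * star (ent i j)) ^ k * (ent l j * star (ent l j))) := by
    rw [← map_sum, ← Finset.mul_sum, sum_ent, mul_one]
  rw [h1, Finset.mul_sum, ← Finset.add_sum_erase _ _ (Finset.mem_univ i),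
    Finset.sum_congr rfl (fun l hl => (step μ i l j (Finset.ne_of_mem_erase hl).symm k).symm),
    Finset.sum_const, Finset.card_erase_of_mem (Finset.mem_univ i), Finset.card_univ,
    Fintype.card_fin, ← pow_succ, nsmul_eq_mul, Nat.cast_sub hn]
  push_cast
  ring

theorem formula (i j : Fin n) (k : ℕ) :
    intL μ ((ent i j * star (ent i j)) ^ k) =
      ((n - 1).factorial : ℂ) * (k.factorial : ℂ) / ((n - 1 + k).factorial : ℂ) := by
  induction k with
  | zero =>
    have : intL μ 1 = ∫ _ : Matrix.unitaryGroup (Fin n) ℂ, (1 : ℂ) ∂μ := rfl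
    simp [this, Nat.factorial_ne_zero]
  | succ k ih =>
    have hr := recur μ i j k
    have hn : 1 ≤ n := Nat.one_le_of_lt i.2
    have hne : ((k : ℂ) + n) ≠ 0 := by
      have : k + n ≠ 0 := by omega
      exact_mod_cast this
    have hf : ((n - 1 + (k + 1)).factorial : ℂ) = ((k : ℂ) + n) * ((n - 1 + k).factorial : ℂ) := by
      rw [← add_assoc, Nat.factorial_succ, show n - 1 + k + 1 = k + n by omega]
      push_cast; ring
    have hf0 : ((n - 1 + k).factorial : ℂ) ≠ 0 := by exact_mod_cast Nat.factorial_ne_zero _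
    apply mul_left_cancel₀ hne
    rw [hr, ih, hf, Nat.factorial_succ]
    push_cast
    field_simp

end

end HaarMoment

/-- If `U` is Haar distributed on the unitary group `U(n)` with `n ≥ 1`, then
for any indices `i, j` and any integer `k ≥ 1`,
`E[|U_{ij}|^(2k)] = (n-1)! k! / (n-1+k)!`. -/
theorem moment_abs_sq_entry_unitary (n : ℕ) (hn : 1 ≤ n)
    (μ : Measure (Matrix.unitaryGroup (Fin n) ℂ))
    [μ.IsHaarMeasure] [IsProbabilityMeasure μ] (i j : Fin n) (k : ℕ) (hk : 1 ≤ k) :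
    ∫ U : Matrix.unitaryGroup (Fin n) ℂ,
        ‖(U : Matrix (Fin n) (Fin n) ℂ) i j‖ ^ (2 * k) ∂μ =
      ((n - 1).factorial : ℝ) * (k.factorial : ℝ) / ((n - 1 + k).factorial : ℝ) := by
  have h := HaarMoment.formula μ i j k
  have h2 : HaarMoment.intL μ ((HaarMoment.ent i j * star (HaarMoment.ent i j)) ^ k) =
      ((∫ U : Matrix.unitaryGroup (Fin n) ℂ,
        ‖(U : Matrix (Fin n) (Fin n) ℂ) i j‖ ^ (2 * k) ∂μ : ℝ) : ℂ) := by
    rw [← integral_complex_ofReal]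
    change ∫ U : Matrix.unitaryGroup (Fin n) ℂ, (U.1 i j * star (U.1 i j)) ^ k ∂μ = _
    congr 1
    ext U
    rw [RCLike.star_def, Complex.mul_conj, Complex.normSq_eq_norm_sq, pow_mul]
    push_cast
    rfl
  rw [h2] at h
  apply Complex.ofReal_injective
  rw [h]
  push_cast
  rfl
end

section
/- Let n ≥ 2, let U be a random matrix distributed according to the Haar probability measure on the unitary group U(n), and for 1 ≤ p, q ≤ n set T_{p,q} = Σ_{i≤p, j≤q} |U_{ij}|². Then E[T_{p,q}] = pq/n and Var(T_{p,q}) = pq (n² − n(p+q) + pq) / (n²(n²−1)). -/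
open MeasureTheory Matrix ProbabilityTheory

/-- `T_{p,q} = Σ_{1 ≤ i ≤ p, 1 ≤ j ≤ q} |U_{ij}|²`, the trace of the product of the upper-left
`p × q` truncation of the unitary matrix `U` with its adjoint. -/
noncomputable def truncTraceU (n p q : ℕ) (U : Matrix.unitaryGroup (Fin n) ℂ) : ℝ :=
  ∑ i : Fin n, ∑ j : Fin n,
    if (i : ℕ) < p ∧ (j : ℕ) < q then ‖(U : Matrix (Fin n) (Fin n) ℂ) i j‖ ^ 2 else 0

namespace HaarAux

theorem measurable_entry {n : ℕ} (i j : Fin n) :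
    Measurable (fun U : Matrix.unitaryGroup (Fin n) ℂ => (U : Matrix (Fin n) (Fin n) ℂ) i j) := by
  have h : Measurable (fun M : Matrix (Fin n) (Fin n) ℂ => M i j) :=
    (measurable_pi_apply j).comp (measurable_pi_apply (X := fun _ : Fin n => Fin n → ℂ) i)
  exact h.comp measurable_subtype_coe

theorem measurable_mk {n : ℕ} {α : Type*} [MeasurableSpace α]
    (f : α → Matrix.unitaryGroup (Fin n) ℂ)
    (h : ∀ i j, Measurable (fun x => (f x : Matrix (Fin n) (Fin n) ℂ) i j)) : Measurable f := by
  apply Measurable.subtype_mk (f := fun x => (f x : Matrix (Fin n) (Fin n) ℂ))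
  exact measurable_pi_lambda (X := fun _ : Fin n => Fin n → ℂ) _
    fun i => measurable_pi_lambda _ fun j => h i j

instance measMul {n : ℕ} : MeasurableMul (Matrix.unitaryGroup (Fin n) ℂ) where
  measurable_const_mul V := by
    apply measurable_mk
    intro i j
    simp only [Submonoid.coe_mul, Matrix.mul_apply]
    exact Finset.measurable_sum _ fun k _ => (measurable_entry k j).const_mul _
  measurable_mul_const V := by
    apply measurable_mk
    intro i j
    simp only [Submonoid.coe_mul, Matrix.mul_apply]
    exact Finset.measurable_sum _ fun k _ => (measurable_entry i k).mul_const _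

/-- permutation matrix as a unitary -/
theorem perm_mem {n : ℕ} (σ : Equiv.Perm (Fin n)) :
    (Matrix.of fun a b : Fin n => if σ a = b then (1 : ℂ) else 0) ∈
      Matrix.unitaryGroup (Fin n) ℂ := by
  rw [Matrix.mem_unitaryGroup_iff]
  ext a b
  simp [Matrix.mul_apply, Matrix.star_apply, Matrix.one_apply, apply_ite]

theorem rot_mem {n : ℕ} (i k : Fin n) (hik : i ≠ k) (w : ℂ) (hw : star w * w = 1) :
    (1 + ((Complex.I - 1) / 2) • Matrix.vecMulVec (Pi.single i 1 + Pi.single k w)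
      (star (Pi.single i 1 + Pi.single k w)) : Matrix (Fin n) (Fin n) ℂ) ∈
      Matrix.unitaryGroup (Fin n) ℂ := by
  set v : Fin n → ℂ := Pi.single i 1 + Pi.single k w with hv
  have hvv : star v ⬝ᵥ v = 2 := by
    have : v i = 1 := by simp [hv, hik]
    have h2 : v k = w := by simp [hv, hik.symm]
    conv_lhs => rw [hv]
    simp only [dotProduct_add, dotProduct_single, Pi.star_apply]
    rw [← hv, this, h2, hw]; norm_num
  rw [Matrix.mem_unitaryGroup_iff, Matrix.star_eq_conjTranspose]
  simp only [conjTranspose_add, conjTranspose_one, conjTranspose_smul, conjTranspose_vecMulVec,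
    star_star, mul_add, add_mul, mul_one, one_mul, smul_mul_assoc, mul_smul_comm,
    vecMulVec_mul_vecMulVec, hvv]
  ext a b
  simp only [Matrix.add_apply, Matrix.smul_apply, smul_eq_mul, vecMulVec_apply, Pi.smul_apply]
  simp
  ring_nf
  simp

section
variable {n : ℕ} (μ : Measure (Matrix.unitaryGroup (Fin n) ℂ))
    [μ.IsHaarMeasure] [IsProbabilityMeasure μ]

theorem perm_inv (f : Matrix (Fin n) (Fin n) ℂ → ℝ) (σ : Equiv.Perm (Fin n)) :
    ∫ U, f (fun a b => (U : Matrix (Fin n) (Fin n) ℂ) (σ a) b) ∂μ = ∫ U, f U ∂μ := by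
  rw [← integral_mul_left_eq_self (fun U : Matrix.unitaryGroup (Fin n) ℂ => f U)
    ⟨_, perm_mem σ⟩]
  congr 1
  ext U
  congr 1
  ext a b
  simp [Matrix.mul_apply]

theorem rot_inv (f : ℂ → ℂ → ℝ) (i k : Fin n) (hik : i ≠ k) (j l : Fin n) (w : ℂ)
    (hw : star w * w = 1) :
    ∫ U : Matrix.unitaryGroup (Fin n) ℂ, f ((1 + Complex.I) / 2 * (U i j + w * U k j))
      ((1 + Complex.I) / 2 * (U i l + w * U k l)) ∂μ = ∫ U, f (U i j) (U i l) ∂μ := by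
  have hw' : star (Complex.I * star w) * (Complex.I * star w) = 1 := by
    simp at hw ⊢
    linear_combination hw - (starRingEnd ℂ) w * w * Complex.I_sq
  rw [← integral_mul_left_eq_self
    (fun U : Matrix.unitaryGroup (Fin n) ℂ => f (U i j) (U i l)) ⟨_, rot_mem i k hik _ hw'⟩]
  congr 1
  ext U
  have key : ∀ m : Fin n, (1 + Complex.I) / 2 * ((U : Matrix (Fin n) (Fin n) ℂ) i m + w * U k m) =
      ((1 + ((Complex.I - 1) / 2) • Matrix.vecMulVec
        (Pi.single i 1 + Pi.single k (Complex.I * star w))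
        (star (Pi.single i 1 + Pi.single k (Complex.I * star w))) : Matrix (Fin n) (Fin n) ℂ)
        * (U : Matrix (Fin n) (Fin n) ℂ)) i m := by
    intro m
    rw [add_mul, one_mul, smul_mul_assoc, vecMulVec_mul]
    simp only [Matrix.add_apply, Matrix.smul_apply, smul_eq_mul, vecMulVec_apply, star_add, add_vecMul,
      Pi.add_apply, Pi.star_single, single_vecMul]
    simp [hik, Pi.star_single]
    linear_combination (w * U k m / 2) * Complex.I_sq
  rw [key, key]
  rfl

/-- bounded integrability -/
theorem integrable_of (f : Matrix.unitaryGroup (Fin n) ℂ → ℝ) (hf : Measurable f) (C : ℝ)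
    (hC : ∀ U, ‖f U‖ ≤ C) : Integrable f μ :=
  Integrable.of_bound hf.aestronglyMeasurable C (Filter.Eventually.of_forall hC)

theorem nrm_le (U : Matrix.unitaryGroup (Fin n) ℂ) (i j : Fin n) :
    ‖(U : Matrix (Fin n) (Fin n) ℂ) i j‖ ≤ 1 := entry_norm_bound_of_unitary U.2 i j

/-- products -/
noncomputable def X (j l i k : Fin n) (U : Matrix (Fin n) (Fin n) ℂ) : ℝ :=
  ‖U i j‖ ^ 2 * ‖U k l‖ ^ 2

/-- mixed products -/
noncomputable def Y (j l i k : Fin n) (U : Matrix (Fin n) (Fin n) ℂ) : ℝ :=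
  ((U i j * star (U i l)) * star (U k j * star (U k l))).re

theorem intA (i j : Fin n) :
    Integrable (fun U : Matrix.unitaryGroup (Fin n) ℂ => ‖(U i j : ℂ)‖ ^ 2) μ := by
  refine integrable_of μ _ ((measurable_entry i j).norm.pow_const 2) 1 fun U => ?_
  rw [norm_pow, norm_norm]
  exact pow_le_one₀ (norm_nonneg _) (nrm_le U i j)

theorem intX (j l i k : Fin n) :
    Integrable (fun U : Matrix.unitaryGroup (Fin n) ℂ => X j l i k U) μ := by
  refine integrable_of μ _ (((measurable_entry i j).norm.pow_const 2).mul
    ((measurable_entry k l).norm.pow_const 2)) 1 fun U => ?_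
  simp only [X, norm_mul, norm_pow, norm_norm]
  exact mul_le_one₀ (pow_le_one₀ (norm_nonneg _) (nrm_le U i j)) (by positivity)
    (pow_le_one₀ (norm_nonneg _) (nrm_le U k l))

theorem intY (j l i k : Fin n) :
    Integrable (fun U : Matrix.unitaryGroup (Fin n) ℂ => Y j l i k U) μ := by
  have h := fun a b => measurable_entry (n := n) a b
  refine integrable_of μ _ ?_ 1 fun U => ?_
  · have hs : Measurable (star : ℂ → ℂ) := continuous_star.measurable
    exact Complex.measurable_re.comp (((h i j).mul (hs.comp (h i l))).mul
      (hs.comp ((h k j).mul (hs.comp (h k l)))))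
  · refine (Complex.abs_re_le_norm _).trans ?_
    simp only [norm_mul, norm_star]
    have := fun a b => nrm_le U a b
    exact mul_le_one₀ (mul_le_one₀ (this _ _) (norm_nonneg _) (this _ _)) (by positivity)
      (mul_le_one₀ (this _ _) (norm_nonneg _) (this _ _))

theorem col_orth (U : Matrix.unitaryGroup (Fin n) ℂ) (j l : Fin n) :
    ∑ i, (U i j : ℂ) * star (U i l : ℂ) = if j = l then 1 else 0 := by
  have h := congrFun (congrFun (Matrix.UnitaryGroup.star_mul_self U) l) j
  rw [Matrix.mul_apply, Matrix.one_apply] at h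
  simp only [Matrix.star_apply] at h
  simp only [eq_comm (a := j)]
  rw [← h]
  exact Finset.sum_congr rfl fun i _ => mul_comm _ _

theorem col_sum (U : Matrix.unitaryGroup (Fin n) ℂ) (j : Fin n) :
    ∑ i, ‖(U i j : ℂ)‖ ^ 2 = 1 := by
  have h := col_orth U j j
  have h2 : ∀ i, (U i j : ℂ) * star (U i j : ℂ) = ((‖(U i j : ℂ)‖ ^ 2 : ℝ) : ℂ) := fun i => by
    rw [Complex.star_def, Complex.mul_conj']; push_cast; rfl
  simp only [h2, if_true] at h
  exact_mod_cast h

theorem sumX (U : Matrix.unitaryGroup (Fin n) ℂ) (j l : Fin n) :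
    ∑ i, ∑ k, X j l i k U = 1 := by
  simp only [X, ← Finset.mul_sum, ← Finset.sum_mul, col_sum, mul_one]

theorem sumY (U : Matrix.unitaryGroup (Fin n) ℂ) (j l : Fin n) :
    ∑ i, ∑ k, Y j l i k U = if j = l then 1 else 0 := by
  simp only [Y, ← Complex.re_sum, ← Finset.mul_sum, ← Finset.sum_mul, ← star_sum, col_orth]
  split_ifs <;> simp

theorem ptwise (x y u v : ℂ) :
    ‖(1 + Complex.I) / 2 * (x + 1 * y)‖ ^ 2 * ‖(1 + Complex.I) / 2 * (u + 1 * v)‖ ^ 2 +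
    ‖(1 + Complex.I) / 2 * (x + -1 * y)‖ ^ 2 * ‖(1 + Complex.I) / 2 * (u + -1 * v)‖ ^ 2 +
    ‖(1 + Complex.I) / 2 * (x + Complex.I * y)‖ ^ 2 *
      ‖(1 + Complex.I) / 2 * (u + Complex.I * v)‖ ^ 2 +
    ‖(1 + Complex.I) / 2 * (x + -Complex.I * y)‖ ^ 2 *
      ‖(1 + Complex.I) / 2 * (u + -Complex.I * v)‖ ^ 2 =
    (‖x‖ ^ 2 * ‖u‖ ^ 2 + ‖x‖ ^ 2 * ‖v‖ ^ 2 + ‖y‖ ^ 2 * ‖u‖ ^ 2 + ‖y‖ ^ 2 * ‖v‖ ^ 2) +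
      2 * ((x * star u) * star (y * star v)).re := by
  simp only [Complex.sq_norm, Complex.normSq_apply, Complex.star_def]
  simp
  ring

theorem exists_perm {i k i' k' : Fin n} (h : i ≠ k) (h' : i' ≠ k') :
    ∃ σ : Equiv.Perm (Fin n), σ i = i' ∧ σ k = k' := by
  refine ⟨(Equiv.swap i i').trans (Equiv.swap (Equiv.swap i i' k) k'), ?_, ?_⟩
  · simp only [Equiv.trans_apply, Equiv.swap_apply_left]
    apply Equiv.swap_apply_of_ne_of_ne _ h'
    intro e
    apply h
    apply (Equiv.swap i i').injective
    rw [← e, Equiv.swap_apply_left]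
  · simp

theorem sum_diag (hn : 2 ≤ n) (g : Fin n → Fin n → ℝ) (a b : ℝ)
    (h : ∀ i k, g i k = if i = k then a else b) :
    ∑ i, ∑ k, g i k = n * a + n * (n - 1) * b := by
  have : ∀ i k, g i k = b + (if i = k then a - b else 0) := fun i k => by
    rw [h]; split_ifs <;> ring
  simp only [this, Finset.sum_add_distrib]
  simp
  ring

theorem mean (hn : 2 ≤ n) (i j : Fin n) :
    ∫ U : Matrix.unitaryGroup (Fin n) ℂ, ‖(U i j : ℂ)‖ ^ 2 ∂μ = 1 / n := by
  have h1 : ∀ k, ∫ U : Matrix.unitaryGroup (Fin n) ℂ, ‖(U k j : ℂ)‖ ^ 2 ∂μ =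
      ∫ U : Matrix.unitaryGroup (Fin n) ℂ, ‖(U i j : ℂ)‖ ^ 2 ∂μ := fun k => by
    rw [← perm_inv μ (fun M => ‖M i j‖ ^ 2) (Equiv.swap i k)]
    simp
  have h2 := integral_finsetSum (μ := μ) Finset.univ (fun k _ => intA μ k j)
  simp only [col_sum, h1] at h2
  simp at h2
  have : (n : ℝ) ≠ 0 := by positivity
  field_simp
  linarith

theorem second (hn : 2 ≤ n) (j l i k : Fin n) :
    ∫ U : Matrix.unitaryGroup (Fin n) ℂ, X j l i k U ∂μ =
      (n - (if j = l then 1 else 0) - (if i = k then 1 else 0) +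
        n * ((if i = k then 1 else 0) * (if j = l then 1 else 0))) / (n * (n ^ 2 - 1)) := by
  have : Nontrivial (Fin n) := Fin.nontrivial_iff_two_le.mpr hn
  obtain ⟨i0, k0, h0⟩ := exists_pair_ne (Fin n)
  set B := ∫ U : Matrix.unitaryGroup (Fin n) ℂ, X j l i0 i0 U ∂μ with hB
  set D := ∫ U : Matrix.unitaryGroup (Fin n) ℂ, X j l i0 k0 U ∂μ with hD
  set F := ∫ U : Matrix.unitaryGroup (Fin n) ℂ, Y j l i0 k0 U ∂μ with hF
  have hX : ∀ i k, ∫ U : Matrix.unitaryGroup (Fin n) ℂ, X j l i k U ∂μ =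
      if i = k then B else D := by
    intro i k
    split_ifs with h
    · subst h
      rw [hB, ← perm_inv μ (X j l i0 i0) (Equiv.swap i0 i)]
      simp [X]
    · obtain ⟨σ, h1, h2⟩ := exists_perm h0 h
      rw [hD, ← perm_inv μ (X j l i0 k0) σ]
      simp [X, h1, h2]
  have hYX : ∀ i (U : Matrix (Fin n) (Fin n) ℂ), Y j l i i U = X j l i i U := by
    intro i U
    simp only [X, Y, Complex.star_def, Complex.mul_conj, Complex.ofReal_re, Complex.normSq_mul,
      Complex.normSq_conj, Complex.normSq_eq_norm_sq]
    rw [norm_mul, RCLike.norm_conj, mul_pow]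
  have hY : ∀ i k, ∫ U : Matrix.unitaryGroup (Fin n) ℂ, Y j l i k U ∂μ =
      if i = k then B else F := by
    intro i k
    split_ifs with h
    · subst h
      simp only [hYX, hX, if_true]
    · obtain ⟨σ, h1, h2⟩ := exists_perm h0 h
      rw [hF, ← perm_inv μ (Y j l i0 k0) σ]
      simp [Y, h1, h2]
  have e1 : n * B + n * (n - 1) * D = 1 := by
    rw [← sum_diag hn _ B D hX]
    simp_rw [← integral_finsetSum Finset.univ (fun k _ => intX μ j l _ k)]
    rw [← integral_finsetSum Finset.univ
      (fun i _ => integrable_finsetSum _ (fun k _ => intX μ j l i k))]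
    simp [sumX]
  have e2 : n * B + n * (n - 1) * F = if j = l then 1 else 0 := by
    rw [← sum_diag hn _ B F hY]
    simp_rw [← integral_finsetSum Finset.univ (fun k _ => intY μ j l _ k)]
    rw [← integral_finsetSum Finset.univ
      (fun i _ => integrable_finsetSum _ (fun k _ => intY μ j l i k))]
    simp [sumY]
  have e3 : 4 * B = (B + D + D + B) + 2 * F := by
    have r := fun w hw => rot_inv μ (fun x u => ‖x‖ ^ 2 * ‖u‖ ^ 2) i0 k0 h0 j l w hw
    have rI : ∀ w : ℂ, star w * w = 1 → Integrable (fun U : Matrix.unitaryGroup (Fin n) ℂ =>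
        ‖(1 + Complex.I) / 2 * (U i0 j + w * U k0 j)‖ ^ 2 *
        ‖(1 + Complex.I) / 2 * (U i0 l + w * U k0 l)‖ ^ 2) μ := by
      intro w hw
      have hm : ∀ m, Measurable (fun U : Matrix.unitaryGroup (Fin n) ℂ =>
          ‖(1 + Complex.I) / 2 * ((U i0 m : ℂ) + w * U k0 m)‖ ^ 2) := fun m =>
        ((((measurable_entry i0 m).add ((measurable_entry k0 m).const_mul w)).const_mul _).norm).pow_const 2
      have hb : ∀ m (U : Matrix.unitaryGroup (Fin n) ℂ),
          ‖(1 + Complex.I) / 2 * ((U i0 m : ℂ) + w * U k0 m)‖ ^ 2 ≤ (2 * (1 + ‖w‖)) ^ 2 := by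
        intro m U
        apply pow_le_pow_left₀ (norm_nonneg _)
        rw [norm_mul]
        apply mul_le_mul _ _ (norm_nonneg _) (by norm_num)
        · rw [norm_div]
          have := norm_add_le (1 : ℂ) Complex.I
          simp at this ⊢
          linarith
        · refine (norm_add_le _ _).trans (add_le_add (nrm_le _ _ _) ?_)
          rw [norm_mul]
          exact mul_le_of_le_one_right (norm_nonneg _) (nrm_le _ _ _)
      refine integrable_of μ _ ((hm j).mul (hm l)) ((2 * (1 + ‖w‖)) ^ 2 * (2 * (1 + ‖w‖)) ^ 2) fun U => ?_
      rw [Real.norm_of_nonneg (by positivity)]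
      exact mul_le_mul (hb j U) (hb l U) (by positivity) (by positivity)
    have w1 : star (1 : ℂ) * 1 = 1 := by simp
    have w2 : star (-1 : ℂ) * -1 = 1 := by simp
    have w3 : star Complex.I * Complex.I = 1 := by simp
    have w4 : star (-Complex.I) * -Complex.I = 1 := by simp
    have hl : 4 * B = B + B + B + B := by ring
    have hB' : B = ∫ U : Matrix.unitaryGroup (Fin n) ℂ, ‖(U i0 j : ℂ)‖ ^ 2 * ‖(U i0 l : ℂ)‖ ^ 2 ∂μ := rfl
    have hs0 := integral_add' (((rI 1 w1).add (rI _ w2)).add (rI _ w3)) (rI _ w4)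
    rw [integral_add' ((rI 1 w1).add (rI _ w2)) (rI _ w3), integral_add' (rI 1 w1) (rI _ w2),
      r 1 w1, r _ w2, r _ w3, r _ w4, ← hB', ← hl] at hs0
    rw [← hs0]
    have q1 := hX i0 i0
    have q2 := hX i0 k0
    have q3 := hX k0 i0
    have q4 := hX k0 k0
    have q5 := hY i0 k0
    simp only [if_true, if_neg h0, if_neg h0.symm] at q1 q2 q3 q4 q5
    have hs := integral_add ((((intX μ j l i0 i0).add (intX μ j l i0 k0)).add
      (intX μ j l k0 i0)).add (intX μ j l k0 k0)) ((intY μ j l i0 k0).const_mul 2)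
    rw [integral_add' (((intX μ j l i0 i0).add (intX μ j l i0 k0)).add
      (intX μ j l k0 i0)) (intX μ j l k0 k0), integral_add' ((intX μ j l i0 i0).add (intX μ j l i0 k0))
      (intX μ j l k0 i0), integral_add' (intX μ j l i0 i0) (intX μ j l i0 k0), integral_const_mul,
      q1, q2, q3, q4, q5] at hs
    rw [← hs]
    refine integral_congr_ae (Filter.Eventually.of_forall fun U => ?_)
    exact ptwise _ _ _ _
  rw [hX]
  have hn' : (2 : ℝ) ≤ n := by exact_mod_cast hn
  have n0 : (n : ℝ) ≠ 0 := by positivity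
  have n1 : (n : ℝ) ^ 2 - 1 ≠ 0 := by nlinarith
  have n2 : (n : ℝ) - 1 ≠ 0 := by linarith
  rw [eq_div_iff (mul_ne_zero n0 n1)]
  generalize hd : (if j = l then (1 : ℝ) else 0) = d at *
  have f1 : (n : ℝ) * (n + 1) * B = 1 + d := by
    linear_combination e1 + e2 + (n : ℝ) * (n - 1) * e3 / 2
  split_ifs
  · linear_combination ((n : ℝ) - 1) * f1
  · linear_combination (n + 1) * e1 - f1
end

end HaarAux

/-- If `U` is Haar distributed on `U(n)` with `n ≥ 2` and `1 ≤ p, q ≤ n`, then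
`E[T_{p,q}] = pq/n` and `Var(T_{p,q}) = pq(n² - n(p+q) + pq)/(n²(n²-1))`. -/
theorem mean_variance_truncTraceU (n : ℕ) (hn : 2 ≤ n)
    (μ : Measure (Matrix.unitaryGroup (Fin n) ℂ))
    [μ.IsHaarMeasure] [IsProbabilityMeasure μ]
    (p q : ℕ) (hp1 : 1 ≤ p) (hpn : p ≤ n) (hq1 : 1 ≤ q) (hqn : q ≤ n) :
    (∫ U, truncTraceU n p q U ∂μ = (p : ℝ) * q / n) ∧
    variance (truncTraceU n p q) μ =
      (p : ℝ) * q * ((n : ℝ) ^ 2 - (n : ℝ) * ((p : ℝ) + q) + (p : ℝ) * q) /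
        ((n : ℝ) ^ 2 * ((n : ℝ) ^ 2 - 1)) := by
  classical
  set r : Fin n → ℝ := fun i => if (i : ℕ) < p then 1 else 0 with hr
  set c : Fin n → ℝ := fun i => if (i : ℕ) < q then 1 else 0 with hc
  have cardlem : ∀ m : ℕ, m ≤ n → ∑ i : Fin n, (if (i : ℕ) < m then (1 : ℝ) else 0) = m := by
    intro m hm
    rw [Fin.sum_univ_eq_sum_range (fun i => if i < m then (1 : ℝ) else 0) n, Finset.sum_ite,
      Finset.sum_const_zero, add_zero, Finset.sum_const, nsmul_eq_mul, mul_one]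
    have : (Finset.range n).filter (fun i => i < m) = Finset.range m := by
      ext x; simp; omega
    rw [this, Finset.card_range]
  have sr : ∑ i, r i = p := cardlem p hpn
  have sc : ∑ i, c i = q := cardlem q hqn
  have rr : ∀ i, r i * r i = r i := fun i => by simp [hr]
  have cc : ∀ i, c i * c i = c i := fun i => by simp [hc]
  have hT : ∀ U : Matrix.unitaryGroup (Fin n) ℂ, truncTraceU n p q U =
      ∑ i, ∑ j, r i * c j * ‖(U i j : ℂ)‖ ^ 2 := by
    intro U
    refine Finset.sum_congr rfl fun i _ => Finset.sum_congr rfl fun j _ => ?_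
    by_cases h1 : (i : ℕ) < p <;> by_cases h2 : (j : ℕ) < q <;> simp [hr, hc, h1, h2]
  have hT2 : ∀ U : Matrix.unitaryGroup (Fin n) ℂ, truncTraceU n p q U ^ 2 =
      ∑ i, ∑ j, ∑ k, ∑ l, r i * c j * (r k * c l) * HaarAux.X j l i k U := by
    intro U
    rw [hT, sq]
    simp only [Finset.sum_mul, Finset.mul_sum]
    refine Finset.sum_congr rfl fun i _ => Finset.sum_congr rfl fun j _ =>
      Finset.sum_congr rfl fun k _ => Finset.sum_congr rfl fun l _ => ?_
    simp only [HaarAux.X]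
    ring
  have hn' : (2 : ℝ) ≤ n := by exact_mod_cast hn
  have n0 : (n : ℝ) ≠ 0 := by positivity
  have n1 : (n : ℝ) ^ 2 - 1 ≠ 0 := by nlinarith
  have hmean : ∫ U, truncTraceU n p q U ∂μ = (p : ℝ) * q / n := by
    simp only [hT]
    rw [integral_finsetSum _ (fun i _ => integrable_finsetSum _
      (fun j _ => (HaarAux.intA μ i j).const_mul _))]
    simp_rw [integral_finsetSum Finset.univ (fun j _ => (HaarAux.intA μ _ j).const_mul _),
      integral_const_mul, HaarAux.mean μ hn, ← Finset.sum_mul, ← Finset.mul_sum, ← Finset.sum_mul,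
      sr, sc]
    ring
  have hsq : ∫ U, truncTraceU n p q U ^ 2 ∂μ =
      ((n : ℝ) * p ^ 2 * q ^ 2 - p ^ 2 * q - p * q ^ 2 + n * p * q) / (n * (n ^ 2 - 1)) := by
    have i1 := fun i j k l => (HaarAux.intX μ j l i k).const_mul (r i * c j * (r k * c l))
    simp only [hT2]
    rw [integral_finsetSum _ (fun i _ => integrable_finsetSum _ (fun j _ =>
      integrable_finsetSum _ (fun k _ => integrable_finsetSum _ (fun l _ => i1 i j k l))))]
    have step : ∀ i, ∫ U : Matrix.unitaryGroup (Fin n) ℂ, ∑ j, ∑ k, ∑ l,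
        r i * c j * (r k * c l) * HaarAux.X j l i k U ∂μ = ∑ j, ∑ k, ∑ l, r i * c j * (r k * c l) *
        ((n - (if j = l then 1 else 0) - (if i = k then 1 else 0) +
        n * ((if i = k then 1 else 0) * (if j = l then 1 else 0))) / (n * (n ^ 2 - 1))) := by
      intro i
      rw [integral_finsetSum _ (fun j _ =>
        integrable_finsetSum _ (fun k _ => integrable_finsetSum _ (fun l _ => i1 i j k l)))]
      refine Finset.sum_congr rfl fun j _ => ?_
      rw [integral_finsetSum _ (fun k _ => integrable_finsetSum _ (fun l _ => i1 i j k l))]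
      refine Finset.sum_congr rfl fun k _ => ?_
      rw [integral_finsetSum _ (fun l _ => i1 i j k l)]
      refine Finset.sum_congr rfl fun l _ => ?_
      rw [integral_const_mul, HaarAux.second μ hn]
    simp only [step]
    have tm : ∀ i j k l : Fin n, r i * c j * (r k * c l) *
        (((n : ℝ) - (if j = l then 1 else 0) - (if i = k then 1 else 0) +
        n * ((if i = k then 1 else 0) * (if j = l then 1 else 0))) / (n * (n ^ 2 - 1))) =
        (n * (r i * (c j * (r k * c l))) - r i * (r k * (if j = l then c j * c l else 0))
        - (if i = k then r i * r k else 0) * (c j * c l)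
        + n * ((if i = k then r i * r k else 0) * (if j = l then c j * c l else 0)))
          / (n * (n ^ 2 - 1)) := by
      intro i j k l
      split_ifs <;> ring
    simp only [tm, ← Finset.sum_div, Finset.sum_add_distrib, Finset.sum_sub_distrib,
      ← Finset.mul_sum, ← Finset.sum_mul, Finset.sum_ite_eq, Finset.mem_univ, if_true, rr, cc,
      sr, sc]
    congr 1
    ring
  refine ⟨hmean, ?_⟩
  have hmeas : Measurable (truncTraceU n p q) := by
    have : truncTraceU n p q = fun U => ∑ i, ∑ j, r i * c j * ‖(U i j : ℂ)‖ ^ 2 := funext hT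
    rw [this]
    exact Finset.measurable_sum _ fun i _ => Finset.measurable_sum _ fun j _ =>
      ((HaarAux.measurable_entry i j).norm.pow_const 2).const_mul _
  have hL : MemLp (truncTraceU n p q) 2 μ := by
    rw [memLp_two_iff_integrable_sq hmeas.aestronglyMeasurable]
    simp only [hT2]
    exact integrable_finsetSum _ fun i _ => integrable_finsetSum _ fun j _ =>
      integrable_finsetSum _ fun k _ => integrable_finsetSum _ fun l _ =>
        (HaarAux.intX μ j l i k).const_mul _
  rw [variance_eq_sub hL]
  simp only [Pi.pow_apply]
  rw [hsq, hmean]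
  field_simp
  ring
end

section
/- For each n ≥ 2 let U^{(n)} be a random matrix distributed according to the Haar probability measure on the unitary group U(n), and for 1 ≤ p, q ≤ n set T^{(n)}_{p,q} = Σ_{i≤p, j≤q} |U^{(n)}_{ij}|². Let p = p(n), q = q(n) be sequences with 1 ≤ p(n), q(n) ≤ n, p(n)/n → s and q(n)/n → t for some s, t ∈ [0,1]. Then (1/n) E[T^{(n)}_{p(n),q(n)}] → s t and Var(T^{(n)}_{p(n),q(n)}) → s t (1−s)(1−t) as n → ∞. -/
open MeasureTheory Matrix ProbabilityTheory Filter

instance bsM {n : ℕ} : BorelSpace (Matrix (Fin n) (Fin n) ℂ) :=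
  inferInstanceAs (BorelSpace (Fin n → Fin n → ℂ))

instance bsU {n : ℕ} : BorelSpace (Matrix.unitaryGroup (Fin n) ℂ) := Subtype.borelSpace _

instance compU {n : ℕ} : CompactSpace (Matrix.unitaryGroup (Fin n) ℂ) := by
  have hK : IsCompact (Set.univ.pi fun _ : Fin n => Set.univ.pi fun _ : Fin n =>
      Metric.closedBall (0 : ℂ) 1) :=
    isCompact_univ_pi fun _ => isCompact_univ_pi fun _ => isCompact_closedBall _ _
  have hc : IsClosed ((Matrix.unitaryGroup (Fin n) ℂ : Set (Matrix (Fin n) (Fin n) ℂ))) := by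
    have : ((Matrix.unitaryGroup (Fin n) ℂ : Set (Matrix (Fin n) (Fin n) ℂ)))
        = {A | A * star A = 1} := by
      ext A
      exact Matrix.mem_unitaryGroup_iff
    rw [this]
    exact isClosed_eq (continuous_id.mul continuous_star) continuous_const
  have : IsCompact ((Matrix.unitaryGroup (Fin n) ℂ : Set (Matrix (Fin n) (Fin n) ℂ))) := by
    refine IsCompact.of_isClosed_subset hK hc ?_
    intro A hA i _ j _
    simpa using entry_norm_bound_of_unitary hA i j
  exact isCompact_iff_compactSpace.mp this

/-- Rotation in the `(i,k)` plane. -/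
noncomputable def rotM {n : ℕ} (i k : Fin n) (a b : ℂ) : Matrix (Fin n) (Fin n) ℂ :=
  1 + single i i (a-1) + single i k b + single k i (-star b) + single k k (star a - 1)

lemma rotM_mem {n : ℕ} (i k : Fin n) (h : i ≠ k) (a b : ℂ) (hab : a * star a + b * star b = 1) :
    rotM i k a b ∈ Matrix.unitaryGroup (Fin n) ℂ := by
  rw [Matrix.mem_unitaryGroup_iff]
  ext r c
  simp only [rotM, star_add, star_one, star_eq_conjTranspose, conjTranspose_single]
  simp [add_mul, mul_add, h, h.symm, single_apply, one_apply]
  have := hab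
  simp only [Complex.star_def] at this
  grind

lemma rotM_row {n : ℕ} (i k : Fin n) (h : i ≠ k) (a b : ℂ) (A : Matrix (Fin n) (Fin n) ℂ) (j) :
    (rotM i k a b * A) i j = a * A i j + b * A k j := by
  simp [rotM, add_mul, h]
  ring

lemma rotM_row2 {n : ℕ} (i k : Fin n) (h : i ≠ k) (a b : ℂ) (A : Matrix (Fin n) (Fin n) ℂ) (j) :
    (rotM i k a b * A) k j = - star b * A i j + star a * A k j := by
  simp [rotM, add_mul, h.symm]
  ring

lemma rotM_row3 {n : ℕ} (i k r : Fin n) (h : r ≠ i) (h' : r ≠ k) (a b : ℂ)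
    (A : Matrix (Fin n) (Fin n) ℂ) (j) :
    (rotM i k a b * A) r j = A r j := by
  simp [rotM, add_mul, h, h']

section moments

set_option linter.unusedSectionVars false

variable {n : ℕ} (μ : Measure (Matrix.unitaryGroup (Fin n) ℂ)) [μ.IsHaarMeasure]
  [IsProbabilityMeasure μ]

lemma cont_int {f : Matrix.unitaryGroup (Fin n) ℂ → ℝ} (hf : Continuous f) : Integrable f μ :=
  hf.integrable_of_hasCompactSupport (HasCompactSupport.of_compactSpace f)

/-- Squared modulus of the entry. -/
noncomputable def nn (U : Matrix.unitaryGroup (Fin n) ℂ) (i j : Fin n) : ℝ :=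
  Complex.normSq ((U : Matrix (Fin n) (Fin n) ℂ) i j)

lemma cont_entry (i j : Fin n) :
    Continuous fun U : Matrix.unitaryGroup (Fin n) ℂ => (U : Matrix (Fin n) (Fin n) ℂ) i j :=
  continuous_subtype_val.matrix_elem i j

lemma cont_nn (i j : Fin n) :
    Continuous fun U : Matrix.unitaryGroup (Fin n) ℂ => nn U i j :=
  Complex.continuous_normSq.comp (cont_entry i j)

lemma nn_swap (i k : Fin n) (h : i ≠ k) : ∃ g : Matrix.unitaryGroup (Fin n) ℂ,
    ∀ U r j, nn (g * U) r j = nn U (Equiv.swap i k r) j := by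
  refine ⟨⟨rotM i k 0 1, rotM_mem i k h 0 1 (by simp)⟩, fun U r j => ?_⟩
  simp only [nn, Submonoid.coe_mul]
  by_cases hi : r = i
  · subst hi
    rw [rotM_row _ _ h]; simp
  by_cases hk : r = k
  · subst hk
    rw [rotM_row2 _ _ h]; simp
  rw [rotM_row3 _ _ _ hi hk, Equiv.swap_apply_of_ne_of_ne hi hk]

/-- Second-order moments. -/
noncomputable def WW (j l i k : Fin n) : ℝ := ∫ U, nn U i j * nn U k l ∂μ

/-- Mixed moments. -/
noncomputable def CC (j l i k : Fin n) : ℝ :=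
  ∫ U : Matrix.unitaryGroup (Fin n) ℂ, ((U : Matrix (Fin n) (Fin n) ℂ) i j * star ((U : Matrix (Fin n) (Fin n) ℂ) i l)
    * star ((U : Matrix (Fin n) (Fin n) ℂ) k j * star ((U : Matrix (Fin n) (Fin n) ℂ) k l))).re ∂μ

lemma WW_swap (j l x y i k : Fin n) :
    WW μ j l x y = WW μ j l (Equiv.swap i k x) (Equiv.swap i k y) := by
  by_cases h : i = k
  · subst h; simp
  obtain ⟨g, hg⟩ := nn_swap i k h
  unfold WW
  rw [← integral_mul_left_eq_self _ g]
  simp only [hg]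

lemma mean_swap (j i k : Fin n) : ∫ U, nn U i j ∂μ = ∫ U, nn U k j ∂μ := by
  by_cases h : i = k
  · subst h; simp
  obtain ⟨g, hg⟩ := nn_swap i k h
  rw [← integral_mul_left_eq_self _ g]
  simp only [hg, Equiv.swap_apply_left]

lemma WW_diag (j l i k : Fin n) : WW μ j l i i = WW μ j l k k := by
  rw [WW_swap μ j l i i i k]; simp

lemma WW_off (j l i k i' k' : Fin n) (h : i ≠ k) (h' : i' ≠ k') :
    WW μ j l i k = WW μ j l i' k' := by
  rw [WW_swap μ j l i k i i', Equiv.swap_apply_left]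
  have h1 : i' ≠ Equiv.swap i i' k := by
    intro e
    have := congrArg (Equiv.swap i i') e
    simp at this
    exact h this
  rw [WW_swap μ j l _ _ (Equiv.swap i i' k) k', Equiv.swap_apply_left,
    Equiv.swap_apply_of_ne_of_ne h1 h']

lemma four_id (x y z w : ℂ) :
    (Complex.normSq (x + y) * Complex.normSq (z + w)
    + Complex.normSq (x - y) * Complex.normSq (z - w)
    + Complex.normSq (x + Complex.I * y) * Complex.normSq (z + Complex.I * w)
    + Complex.normSq (x - Complex.I * y) * Complex.normSq (z - Complex.I * w)) =
    4 * ((Complex.normSq x + Complex.normSq y) * (Complex.normSq z + Complex.normSq w)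
     + 2 * (x * star z * star (y * star w)).re) := by
  simp [Complex.normSq_apply]
  ring

lemma rot_WW (j l i k : Fin n) (h : i ≠ k) (w : ℂ) (hw : w * star w = 1) :
    ∫ U : Matrix.unitaryGroup (Fin n) ℂ, Complex.normSq ((U : Matrix (Fin n) (Fin n) ℂ) i j + w * (U : Matrix (Fin n) (Fin n) ℂ) k j)
      * Complex.normSq ((U : Matrix (Fin n) (Fin n) ℂ) i l + w * (U : Matrix (Fin n) (Fin n) ℂ) k l) ∂μ
      = 4 * WW μ j l i i := by
  have hr : ((√2 : ℝ) : ℂ) * ((√2 : ℝ) : ℂ) = 2 := by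
    rw [← Complex.ofReal_mul, Real.mul_self_sqrt (by norm_num)]; simp
  have hr0 : ((√2 : ℝ) : ℂ) ≠ 0 := by simp
  have hm : rotM i k (((√2 : ℝ) : ℂ)⁻¹) (((√2 : ℝ) : ℂ)⁻¹ * w) ∈ Matrix.unitaryGroup (Fin n) ℂ := by
    apply rotM_mem i k h
    simp only [star_mul', star_inv₀, Complex.star_def, Complex.conj_ofReal] at hw ⊢
    have : ((√2 : ℝ) : ℂ)⁻¹ * ((√2 : ℝ) : ℂ)⁻¹ = 1/2 := by
      rw [← mul_inv, hr]; norm_num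
    linear_combination (1 + w * (starRingEnd ℂ) w) * this + hw / 2
  unfold WW
  rw [← integral_mul_left_eq_self (fun U => nn U i j * nn U i l) ⟨_, hm⟩]
  rw [← integral_const_mul]
  congr 1
  ext U
  simp only [nn, Submonoid.coe_mul]
  rw [rotM_row _ _ h, rotM_row _ _ h]
  have key : ∀ a b : ℂ, Complex.normSq (((√2 : ℝ) : ℂ)⁻¹ * a + ((√2 : ℝ) : ℂ)⁻¹ * w * b)
      = 1/2 * Complex.normSq (a + w * b) := by
    intro a b
    rw [mul_assoc, ← mul_add, Complex.normSq_mul, Complex.normSq_inv, Complex.normSq_ofReal,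
      Real.mul_self_sqrt (by norm_num)]
    norm_num
  rw [key, key]
  ring

lemma int_comb {f1 f2 f3 f4 g1 g2 g3 g4 h : Matrix.unitaryGroup (Fin n) ℂ → ℝ}
    (hf1 : Integrable f1 μ) (hf2 : Integrable f2 μ) (hf3 : Integrable f3 μ) (hf4 : Integrable f4 μ)
    (hg1 : Integrable g1 μ) (hg2 : Integrable g2 μ) (hg3 : Integrable g3 μ) (hg4 : Integrable g4 μ)
    (hh : Integrable h μ)
    (e : ∀ U, f1 U + f2 U + f3 U + f4 U = 4 * ((g1 U + g2 U + g3 U + g4 U) + 2 * h U)) :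
    ∫ U, f1 U ∂μ + ∫ U, f2 U ∂μ + ∫ U, f3 U ∂μ + ∫ U, f4 U ∂μ =
      4 * ((∫ U, g1 U ∂μ + ∫ U, g2 U ∂μ + ∫ U, g3 U ∂μ + ∫ U, g4 U ∂μ) + 2 * ∫ U, h U ∂μ) := by
  have l := integral_congr_ae (μ := μ) (Eventually.of_forall e)
  rw [integral_add (f := fun U => f1 U + f2 U + f3 U) ((hf1.add hf2).add hf3) hf4,
    integral_add (f := fun U => f1 U + f2 U) (hf1.add hf2) hf3, integral_add hf1 hf2,
    integral_const_mul,
    integral_add (f := fun U => g1 U + g2 U + g3 U + g4 U) (((hg1.add hg2).add hg3).add hg4)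
      (hh.const_mul 2),
    integral_add (f := fun U => g1 U + g2 U + g3 U) ((hg1.add hg2).add hg3) hg4,
    integral_add (f := fun U => g1 U + g2 U) (hg1.add hg2) hg3, integral_add hg1 hg2,
    integral_const_mul] at l
  exact l

lemma CC_eq (j l i k : Fin n) (h : i ≠ k) :
    CC μ j l i k = WW μ j l i i - WW μ j l i k := by
  have e1 := rot_WW μ j l i k h 1 (by simp)
  have e2 := rot_WW μ j l i k h (-1) (by simp)
  have e3 := rot_WW μ j l i k h Complex.I (by simp)
  have e4 := rot_WW μ j l i k h (-Complex.I) (by simp)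
  have hc : ∀ w : ℂ, Integrable (fun U : Matrix.unitaryGroup (Fin n) ℂ => Complex.normSq ((U : Matrix (Fin n) (Fin n) ℂ) i j + w * (U : Matrix (Fin n) (Fin n) ℂ) k j)
      * Complex.normSq ((U : Matrix (Fin n) (Fin n) ℂ) i l + w * (U : Matrix (Fin n) (Fin n) ℂ) k l)) μ := by
    intro w
    apply cont_int
    exact (Complex.continuous_normSq.comp ((cont_entry i j).add (continuous_const.mul (cont_entry k j)))).mul
      (Complex.continuous_normSq.comp ((cont_entry i l).add (continuous_const.mul (cont_entry k l))))
  have hw : ∀ a b, Integrable (fun U => nn U a j * nn U b l) μ := fun a b =>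
    cont_int μ ((cont_nn a j).mul (cont_nn b l))
  have hcc : Integrable (fun U : Matrix.unitaryGroup (Fin n) ℂ => ((U : Matrix (Fin n) (Fin n) ℂ) i j * star ((U : Matrix (Fin n) (Fin n) ℂ) i l)
    * star ((U : Matrix (Fin n) (Fin n) ℂ) k j * star ((U : Matrix (Fin n) (Fin n) ℂ) k l))).re) μ := by
    apply cont_int
    exact Complex.continuous_re.comp (((cont_entry i j).mul (cont_entry i l).star).mul
      ((cont_entry k j).mul (cont_entry k l).star).star)
  have tot : 4 * WW μ j l i i + 4 * WW μ j l i i + 4 * WW μ j l i i + 4 * WW μ j l i i =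
      4 * ((WW μ j l i i + WW μ j l i k + WW μ j l k i + WW μ j l k k) + 2 * CC μ j l i k) := by
    nth_rw 1 [← e1]
    nth_rw 1 [← e2]
    nth_rw 1 [← e3]
    nth_rw 1 [← e4]
    unfold WW CC
    refine int_comb μ (hc _) (hc _) (hc _) (hc _) (hw _ _) (hw _ _) (hw _ _) (hw _ _) hcc ?_
    intro U
    have := four_id ((U : Matrix (Fin n) (Fin n) ℂ) i j) ((U : Matrix (Fin n) (Fin n) ℂ) k j)
      ((U : Matrix (Fin n) (Fin n) ℂ) i l) ((U : Matrix (Fin n) (Fin n) ℂ) k l)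
    simp only [nn, one_mul, neg_mul, ← sub_eq_add_neg]
    rw [this]
    ring
  rw [WW_diag μ j l k i, WW_off μ j l k i i k h.symm h] at tot
  linarith

lemma col_sum (U : Matrix.unitaryGroup (Fin n) ℂ) (j l : Fin n) :
    ∑ i, (U : Matrix (Fin n) (Fin n) ℂ) i j * star ((U : Matrix (Fin n) (Fin n) ℂ) i l)
      = if j = l then 1 else 0 := by
  have h := Matrix.mem_unitaryGroup_iff'.mp U.2
  have h2 := congrFun (congrFun h l) j
  rw [Matrix.mul_apply, Matrix.one_apply] at h2
  simp only [star_apply] at h2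
  rw [show (if j = l then (1:ℂ) else 0) = if l = j then 1 else 0 by simp [eq_comm], ← h2]
  exact Finset.sum_congr rfl fun i _ => mul_comm _ _

lemma nn_sum (U : Matrix.unitaryGroup (Fin n) ℂ) (j : Fin n) : ∑ i, nn U i j = 1 := by
  have h := congrArg Complex.re (col_sum U j j)
  simpa [nn, Complex.mul_conj] using h

lemma sum_diag_off (i : Fin n) (f : Fin n → ℝ) (a b : ℝ) (S : Finset (Fin n)) (hi : i ∈ S)
    (ha : f i = a) (hb : ∀ k, i ≠ k → f k = b) :
    ∑ k ∈ S, f k = a + ((S.card : ℝ) - 1) * b := by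
  rw [← Finset.add_sum_erase _ _ hi, ha, Finset.sum_congr rfl (g := fun _ => b)]
  · rw [Finset.sum_const, nsmul_eq_mul, Finset.card_erase_of_mem hi, Nat.cast_sub]
    · simp
    · exact Finset.card_pos.mpr ⟨i, hi⟩
  · intro k hk
    exact hb k (Finset.ne_of_mem_erase hk).symm

lemma mean_val (i j : Fin n) : ∫ U, nn U i j ∂μ = 1 / n := by
  have h : ∑ k, ∫ U, nn U k j ∂μ = 1 := by
    rw [← integral_finsetSum _ fun k _ => cont_int μ (cont_nn k j)]
    simp [nn_sum]
  rw [Finset.sum_congr rfl fun k _ => mean_swap μ j k i] at h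
  simp at h
  have : (n : ℝ) ≠ 0 := by
    rintro h0; rw [h0] at h; simp at h
  field_simp
  linarith

lemma WW_total (j l : Fin n) : ∑ i, ∑ k, WW μ j l i k = 1 := by
  have hw : ∀ a b, Integrable (fun U => nn U a j * nn U b l) μ := fun a b =>
    cont_int μ ((cont_nn a j).mul (cont_nn b l))
  unfold WW
  simp_rw [← integral_finsetSum _ fun k _ => hw _ k]
  rw [← integral_finsetSum _ fun i _ => integrable_finsetSum _ fun k _ => hw i k]
  simp [← Finset.mul_sum, nn_sum]

lemma CC_total (j l : Fin n) : ∑ i, ∑ k, CC μ j l i k = if j = l then 1 else 0 := by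
  have hw : ∀ i k, Integrable (fun U : Matrix.unitaryGroup (Fin n) ℂ => ((U : Matrix (Fin n) (Fin n) ℂ) i j * star ((U : Matrix (Fin n) (Fin n) ℂ) i l)
    * star ((U : Matrix (Fin n) (Fin n) ℂ) k j * star ((U : Matrix (Fin n) (Fin n) ℂ) k l))).re) μ := by
    intro i k
    apply cont_int
    exact Complex.continuous_re.comp (((cont_entry i j).mul (cont_entry i l).star).mul
      ((cont_entry k j).mul (cont_entry k l).star).star)
  unfold CC
  simp_rw [← integral_finsetSum _ fun k _ => hw _ k]
  rw [← integral_finsetSum _ fun i _ => integrable_finsetSum _ fun k _ => hw i k]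
  simp_rw [← Complex.re_sum, ← Finset.mul_sum, ← star_sum, ← Finset.sum_mul, col_sum]
  split_ifs <;> simp

lemma CC_diag (j l i : Fin n) : CC μ j l i i = WW μ j l i i := by
  unfold CC WW
  congr 1
  ext U
  simp [nn, Complex.normSq_apply]
  ring

lemma WW_val (hn : 2 ≤ n) (j l i k : Fin n) : WW μ j l i k =
    if j = l then (if i = k then 2 / ((n : ℝ) * (n + 1)) else 1 / ((n : ℝ) * (n + 1)))
    else (if i = k then 1 / ((n : ℝ) * (n + 1)) else 1 / ((n : ℝ) ^ 2 - 1)) := by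
  let x : Fin n := ⟨0, by omega⟩
  let y : Fin n := ⟨1, by omega⟩
  have hxy : x ≠ y := by simp [x, y]
  obtain ⟨a, ha⟩ : ∃ a, a = WW μ j l x x := ⟨_, rfl⟩
  obtain ⟨b, hb⟩ : ∃ b, b = WW μ j l x y := ⟨_, rfl⟩
  have hA : ∀ r, WW μ j l r r = a := fun r => by rw [ha]; exact WW_diag μ j l r x
  have hB : ∀ r s, r ≠ s → WW μ j l r s = b := fun r s h => by
    rw [hb]; exact WW_off μ j l r s x y h hxy
  have h1 := WW_total μ j l
  have h2 := CC_total μ j l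
  rw [Finset.sum_congr rfl fun r _ => sum_diag_off r _ a b Finset.univ (Finset.mem_univ _) (hA r)
    (fun s hs => hB r s hs)] at h1
  rw [Finset.sum_congr rfl fun r _ => sum_diag_off r _ a (a - b) Finset.univ (Finset.mem_univ _)
    ((CC_diag μ j l r).trans (hA r))
    (fun s hs => by rw [CC_eq μ j l r s hs, hA, hB r s hs])] at h2
  simp at h1 h2
  have hn' : (2 : ℝ) ≤ n := by exact_mod_cast hn
  have n0 : (n : ℝ) ≠ 0 := by positivity
  have n1 : (n : ℝ) + 1 ≠ 0 := by positivity
  have n2 : (n : ℝ) - 1 ≠ 0 := by linarith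
  have n3 : (n : ℝ) ^ 2 - 1 ≠ 0 := by
    rw [show (n : ℝ) ^ 2 - 1 = (n - 1) * (n + 1) by ring]; positivity
  have hval : WW μ j l i k = if i = k then a else b := by
    split_ifs with h
    · rw [h]; exact hA k
    · exact hB i k h
  rw [hval]
  by_cases hjl : j = l
  · simp only [hjl, if_true] at h2 ⊢
    have hav : a = 2 / ((n : ℝ) * (n + 1)) := by
      field_simp; linear_combination h1 + h2
    have hbv : b = 1 / ((n : ℝ) * (n + 1)) := by
      have : (n : ℝ) * (n - 1) * b = 1 - n * a := by linear_combination h1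
      rw [hav] at this
      field_simp at this ⊢
      apply mul_left_cancel₀ n2
      linear_combination this
    rw [hav, hbv]
  · simp only [hjl, if_false] at h2 ⊢
    have hav : a = 1 / ((n : ℝ) * (n + 1)) := by
      field_simp; linear_combination h1 + h2
    have hbv : b = 1 / ((n : ℝ) ^ 2 - 1) := by
      have : (n : ℝ) * (n - 1) * b = 1 - n * a := by linear_combination h1
      rw [hav] at this
      field_simp at this ⊢
      apply mul_left_cancel₀ n0
      linear_combination this
    rw [hav, hbv]

lemma trunc_eq (p q : ℕ) (U : Matrix.unitaryGroup (Fin n) ℂ) :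
    truncTraceU n p q U = ∑ j ∈ Finset.univ.filter (fun j : Fin n => (j : ℕ) < q),
      ∑ i ∈ Finset.univ.filter (fun i : Fin n => (i : ℕ) < p), nn U i j := by
  unfold truncTraceU
  rw [Finset.sum_comm, Finset.sum_filter]
  refine Finset.sum_congr rfl fun j _ => ?_
  rw [Finset.sum_filter]
  split_ifs with h
  · refine Finset.sum_congr rfl fun i _ => ?_
    simp [h, nn, Complex.sq_norm]
  · simp [h]

lemma card_lt (p : ℕ) (hp : p ≤ n) :
    (Finset.univ.filter (fun i : Fin n => (i : ℕ) < p)).card = p := by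
  rw [Fin.card_filter_val_lt, min_eq_right hp]

lemma cont_trunc (p q : ℕ) : Continuous (truncTraceU n p q) := by
  rw [funext (trunc_eq (n := n) p q)]
  exact continuous_finsetSum _ fun j _ => continuous_finsetSum _ fun i _ => cont_nn i j

lemma mean_trunc (p q : ℕ) (hp : p ≤ n) (hq : q ≤ n) :
    ∫ U, truncTraceU n p q U ∂μ = p * q / n := by
  simp_rw [trunc_eq]
  rw [integral_finsetSum _ fun j _ => cont_int μ (continuous_finsetSum _ fun i _ => cont_nn i j)]
  simp_rw [integral_finsetSum _ fun i _ => cont_int μ (cont_nn i _), mean_val, Finset.sum_const,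
    card_lt p hp, card_lt q hq]
  simp
  ring

lemma sq_trunc (hn : 2 ≤ n) (p q : ℕ) (hp : p ≤ n) (hq : q ≤ n) :
    ∫ U, truncTraceU n p q U ^ 2 ∂μ = q * (p * ((p : ℝ) + 1) / (n * (n + 1)))
      + q * ((q : ℝ) - 1) * (p * (1 / (n * (n + 1))) + p * (p - 1) * (1 / ((n : ℝ) ^ 2 - 1))) := by
  have hw : ∀ j l a b, Integrable (fun U => nn U a j * nn U b l) μ := fun j l a b =>
    cont_int μ ((cont_nn a j).mul (cont_nn b l))
  set P := Finset.univ.filter (fun i : Fin n => (i : ℕ) < p) with hP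
  set Q := Finset.univ.filter (fun i : Fin n => (i : ℕ) < q) with hQ
  have hPc : (P.card : ℝ) = p := by rw [hP, card_lt p hp]
  have hQc : (Q.card : ℝ) = q := by rw [hQ, card_lt q hq]
  have e : ∫ U, truncTraceU n p q U ^ 2 ∂μ = ∑ j ∈ Q, ∑ l ∈ Q, ∑ i ∈ P, ∑ k ∈ P, WW μ j l i k := by
    simp_rw [trunc_eq, sq, Finset.sum_mul_sum]
    rw [integral_finsetSum _ fun j _ => integrable_finsetSum _ fun l _ =>
      integrable_finsetSum _ fun i _ => integrable_finsetSum _ fun k _ => hw j l i k]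
    refine Finset.sum_congr rfl fun j _ => ?_
    rw [integral_finsetSum _ fun l _ =>
      integrable_finsetSum _ fun i _ => integrable_finsetSum _ fun k _ => hw j l i k]
    refine Finset.sum_congr rfl fun l _ => ?_
    rw [integral_finsetSum _ fun i _ => integrable_finsetSum _ fun k _ => hw j l i k]
    refine Finset.sum_congr rfl fun i _ => ?_
    rw [integral_finsetSum _ fun k _ => hw j l i k]
    rfl
  have inner : ∀ j l, ∑ i ∈ P, ∑ k ∈ P, WW μ j l i k = if j = l then p * ((p : ℝ) + 1) / (n * (n + 1))
      else (p * (1 / (n * (n + 1))) + p * (p - 1) * (1 / ((n : ℝ) ^ 2 - 1))) := by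
    intro j l
    split_ifs with h
    · rw [Finset.sum_congr rfl fun i hi => sum_diag_off i _ (2 / ((n : ℝ) * (n + 1)))
        (1 / ((n : ℝ) * (n + 1))) P hi (by rw [WW_val μ hn]; simp [h])
        (fun k hk => by rw [WW_val μ hn]; simp [h, hk])]
      rw [Finset.sum_const, nsmul_eq_mul, hPc]
      ring
    · rw [Finset.sum_congr rfl fun i hi => sum_diag_off i _ (1 / ((n : ℝ) * (n + 1)))
        (1 / ((n : ℝ) ^ 2 - 1)) P hi (by rw [WW_val μ hn]; simp [h])
        (fun k hk => by rw [WW_val μ hn]; simp [h, hk])]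
      rw [Finset.sum_const, nsmul_eq_mul, hPc]
      ring
  rw [e, Finset.sum_congr rfl fun j hj => sum_diag_off j _ _ _ Q hj ((inner j j).trans (if_pos rfl))
    (fun l hl => (inner j l).trans (if_neg hl))]
  rw [Finset.sum_const, nsmul_eq_mul, hQc]
  ring

lemma var_trunc (hn : 2 ≤ n) (p q : ℕ) (hp : p ≤ n) (hq : q ≤ n) :
    variance (truncTraceU n p q) μ =
      ((p : ℝ) / n) * (q / n) * (1 - p / n) * (1 - q / n) * (1 + 1 / ((n : ℝ) ^ 2 - 1)) := by
  have hm : MemLp (truncTraceU n p q) 2 μ :=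
    (cont_trunc p q).memLp_of_hasCompactSupport (HasCompactSupport.of_compactSpace _)
  rw [variance_eq_sub hm]
  simp only [Pi.pow_apply]
  rw [sq_trunc μ hn p q hp hq, mean_trunc μ p q hp hq]
  have hn' : (2 : ℝ) ≤ n := by exact_mod_cast hn
  have n0 : (n : ℝ) ≠ 0 := by positivity
  have n1 : (n : ℝ) + 1 ≠ 0 := by positivity
  have n2 : (n : ℝ) - 1 ≠ 0 := by linarith
  rw [show (n : ℝ) ^ 2 - 1 = (n - 1) * (n + 1) by ring]
  field_simp
  ring

end moments

/-- If `U⁽ⁿ⁾` is Haar distributed on `U(n)`, and `p(n)/n → s`, `q(n)/n → t`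
with `1 ≤ p(n), q(n) ≤ n` and `s, t ∈ [0,1]`, then `(1/n) E[T_{p(n),q(n)}] → st` and
`Var(T_{p(n),q(n)}) → st(1-s)(1-t)`. -/
theorem limit_mean_variance_truncTraceU
    (μ : ∀ n : ℕ, Measure (Matrix.unitaryGroup (Fin n) ℂ))
    (hHaar : ∀ n, (μ n).IsHaarMeasure) (hProb : ∀ n, IsProbabilityMeasure (μ n))
    (p q : ℕ → ℕ)
    (hp : ∀ n, 2 ≤ n → 1 ≤ p n ∧ p n ≤ n) (hq : ∀ n, 2 ≤ n → 1 ≤ q n ∧ q n ≤ n)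
    (s t : ℝ) (hs : s ∈ Set.Icc (0 : ℝ) 1) (ht : t ∈ Set.Icc (0 : ℝ) 1)
    (hps : Tendsto (fun n : ℕ => (p n : ℝ) / n) atTop (nhds s))
    (hqt : Tendsto (fun n : ℕ => (q n : ℝ) / n) atTop (nhds t)) :
    Tendsto (fun n : ℕ => (1 / (n : ℝ)) * ∫ U, truncTraceU n (p n) (q n) U ∂(μ n))
      atTop (nhds (s * t)) ∧
    Tendsto (fun n : ℕ => variance (truncTraceU n (p n) (q n)) (μ n))
      atTop (nhds (s * t * (1 - s) * (1 - t))) := by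
  constructor
  · refine (hps.mul hqt).congr' ?_
    filter_upwards [eventually_ge_atTop 2] with n hn
    have := hHaar n
    have := hProb n
    rw [mean_trunc (μ n) _ _ (hp n hn).2 (hq n hn).2]
    ring
  · have hz : Tendsto (fun n : ℕ => 1 / ((n : ℝ) ^ 2 - 1)) atTop (nhds 0) := by
      refine Tendsto.div_atTop tendsto_const_nhds ?_
      refine tendsto_atTop_add_const_right _ _ ?_
      exact (tendsto_pow_atTop two_ne_zero).comp tendsto_natCast_atTop_atTop
    have hl := (((hps.mul hqt).mul (hps.const_sub 1)).mul (hqt.const_sub 1)).mul (hz.const_add 1)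
    rw [add_zero, mul_one] at hl
    refine hl.congr' ?_
    filter_upwards [eventually_ge_atTop 2] with n hn
    have := hHaar n
    have := hProb n
    rw [var_trunc (μ n) hn _ _ (hp n hn).2 (hq n hn).2]
end

section
/- Let n ≥ 2, let U be a random matrix distributed according to the Haar probability measure on the unitary group U(n), and for 1 ≤ p, q ≤ n set T_{p,q} = Σ_{i≤p, j≤q} |U_{ij}|². Then for all 1 ≤ p, p', q, q' ≤ n, Cov(T_{p,q}, T_{p',q'}) = (p∧p')(q∧q')/(n²−1) − (p∧p') q q' / (n(n²−1)) − p p' (q∧q') / (n(n²−1)) + p p' q q' / (n²(n²−1)). -/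
open MeasureTheory Matrix

namespace CovAux

instance measMul (n : ℕ) : MeasurableMul (Matrix.unitaryGroup (Fin n) ℂ) where
  measurable_const_mul := by
    intro c
    refine Measurable.subtype_mk ?_
    refine measurable_pi_lambda _ fun i => measurable_pi_lambda _ fun j => ?_
    have : ∀ k l, Measurable fun U : Matrix.unitaryGroup (Fin n) ℂ => (U : Matrix (Fin n) (Fin n) ℂ) k l := by
      intro k l
      exact (measurable_pi_apply l).comp ((measurable_pi_apply k).comp measurable_subtype_coe)
    simp only [Matrix.mul_apply]
    exact Finset.measurable_sum _ fun k _ => (this k j).const_mul _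
  measurable_mul_const := by
    intro c
    refine Measurable.subtype_mk ?_
    refine measurable_pi_lambda _ fun i => measurable_pi_lambda _ fun j => ?_
    have : ∀ k l, Measurable fun U : Matrix.unitaryGroup (Fin n) ℂ => (U : Matrix (Fin n) (Fin n) ℂ) k l := by
      intro k l
      exact (measurable_pi_apply l).comp ((measurable_pi_apply k).comp measurable_subtype_coe)
    simp only [Matrix.mul_apply]
    exact Finset.measurable_sum _ fun k _ => (this i k).mul_const _

/-- entry -/
noncomputable def ent {n : ℕ} (i j : Fin n) (U : Matrix.unitaryGroup (Fin n) ℂ) : ℂ :=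
  (U : Matrix (Fin n) (Fin n) ℂ) i j

lemma ent_meas {n : ℕ} (i j : Fin n) : Measurable (ent i j) :=
  (measurable_pi_apply j).comp ((measurable_pi_apply i).comp measurable_subtype_coe)

lemma ent_le {n : ℕ} (i j : Fin n) (U : Matrix.unitaryGroup (Fin n) ℂ) : ‖ent i j U‖ ≤ 1 :=
  entry_norm_bound_of_unitary U.2 i j

lemma ent_orth {n : ℕ} (j l : Fin n) (U : Matrix.unitaryGroup (Fin n) ℂ) :
    ∑ i, ent i j U * star (ent i l U) = if j = l then 1 else 0 := by
  have h := (Matrix.mem_unitaryGroup_iff').1 U.2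
  have h2 := congrFun (congrFun h l) j
  rw [Matrix.mul_apply, Matrix.one_apply] at h2
  rw [show (if j = l then (1 : ℂ) else 0) = if l = j then 1 else 0 by simp [eq_comm], ← h2]
  refine Finset.sum_congr rfl fun i _ => ?_
  rw [mul_comm]; rfl

lemma ent_norm {n : ℕ} (j : Fin n) (U : Matrix.unitaryGroup (Fin n) ℂ) :
    ∑ i, ‖ent i j U‖ ^ 2 = 1 := by
  have h := ent_orth j j U
  simp only [if_true] at h
  have h3 : ((∑ i, ‖ent i j U‖ ^ 2 : ℝ) : ℂ) = 1 := by
    rw [← h]; push_cast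
    exact Finset.sum_congr rfl fun i _ => (Complex.mul_conj' _).symm
  exact_mod_cast h3

/-- permutation unitary -/
noncomputable def permU {n : ℕ} (σ : Equiv.Perm (Fin n)) : Matrix.unitaryGroup (Fin n) ℂ :=
  ⟨(Matrix.of fun i j => if σ i = j then (1 : ℂ) else 0), by
    rw [Matrix.mem_unitaryGroup_iff]
    ext i j
    simp [Matrix.mul_apply, Matrix.one_apply, Matrix.star_apply, eq_comm]⟩

lemma ent_perm {n : ℕ} (σ : Equiv.Perm (Fin n)) (i j : Fin n) (U) :
    ent i j (permU σ * U) = ent (σ i) j U := by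
  simp [ent, permU, Matrix.mul_apply]

/-- mixing matrix -/
noncomputable def mixM {n : ℕ} (i k : Fin n) (ω : ℂ) : Matrix (Fin n) (Fin n) ℂ :=
  1 - ((1 - Complex.I) / 2) • Matrix.vecMulVec (Pi.single i 1 - ω • Pi.single k 1)
    (star (Pi.single i 1 - ω • Pi.single k 1))

lemma mix_mem {n : ℕ} (i k : Fin n) (hik : i ≠ k) (ω : ℂ) (hω : ω * star ω = 1) :
    mixM i k ω ∈ Matrix.unitaryGroup (Fin n) ℂ := by
  rw [Matrix.mem_unitaryGroup_iff, mixM]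
  generalize hv : (Pi.single i 1 - ω • Pi.single k 1 : Fin n → ℂ) = v
  have hvv : star v ⬝ᵥ v = 2 := by
    have e : star v = Pi.single i 1 - star ω • Pi.single k 1 := by
      rw [← hv, star_sub, star_smul, Pi.star_single, Pi.star_single, star_one]
    rw [e, sub_dotProduct, smul_dotProduct, single_dotProduct, single_dotProduct]
    simp [← hv, hik, hik.symm]
    have : (starRingEnd ℂ) ω * ω = 1 := by rw [mul_comm]; exact hω
    rw [this]; norm_num
  have hs : star (Matrix.vecMulVec v (star v)) = Matrix.vecMulVec v (star v) := by
    ext x y; simp [Matrix.star_apply, Matrix.vecMulVec_apply, mul_comm]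
  have hP : Matrix.vecMulVec v (star v) * Matrix.vecMulVec v (star v)
      = (2 : ℂ) • Matrix.vecMulVec v (star v) := by
    rw [Matrix.vecMulVec_mul_vecMulVec, hvv]
    ext x y; simp [Matrix.vecMulVec_apply]; try ring
  rw [star_sub, star_one, star_smul, hs]
  generalize Matrix.vecMulVec v (star v) = P at *
  rw [sub_mul, mul_sub, mul_sub, Matrix.smul_mul, Matrix.mul_smul, Matrix.mul_smul, Matrix.smul_mul, hP, one_mul, one_mul,
    mul_one]
  have hc : star ((1 - Complex.I) / 2) = (1 + Complex.I) / 2 := by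
    simp
  rw [hc, smul_smul, smul_smul]
  have : (1 + Complex.I) / 2 * ((1 - Complex.I) / 2) * 2 =
      (1 - Complex.I) / 2 + (1 + Complex.I) / 2 := by
    linear_combination (-1 / 2) * Complex.I_sq
  rw [this, add_smul]
  abel

lemma ent_mix {n : ℕ} (i k : Fin n) (hik : i ≠ k) (ω : ℂ) (hω : ω * star ω = 1) (j : Fin n) (U) :
    ent i j (⟨mixM i k ω, mix_mem i k hik ω hω⟩ * U) =
      (1 + Complex.I) / 2 * ent i j U + (1 - Complex.I) / 2 * star ω * ent k j U := by
  have h : mixM i k ω i = fun x => (if x = i then (1 + Complex.I) / 2 else 0) +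
      (if x = k then (1 - Complex.I) / 2 * star ω else 0) := by
    funext x
    by_cases h1 : x = i
    · subst h1; simp [mixM, Matrix.vecMulVec_apply, hik]; ring
    · by_cases h2 : x = k
      · subst h2; simp [mixM, Matrix.vecMulVec_apply, hik, hik.symm]
      · simp [mixM, Matrix.vecMulVec_apply, h1, h2, hik, Ne.symm h1]
  simp only [ent, Matrix.UnitaryGroup.mul_val, Matrix.mul_apply]
  rw [h]
  simp [add_mul, Finset.sum_add_distrib]

section
variable {n : ℕ} (μ : Measure (Matrix.unitaryGroup (Fin n) ℂ))
    [μ.IsHaarMeasure] [IsProbabilityMeasure μ]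

/-- F -/
noncomputable def F (j l i k : Fin n) : ℝ := ∫ U, ‖ent i j U‖ ^ 2 * ‖ent k l U‖ ^ 2 ∂μ
/-- G integrand -/
noncomputable def g (j l i k : Fin n) (U : Matrix.unitaryGroup (Fin n) ℂ) : ℝ :=
  (ent i j U * star (ent i l U) * star (ent k j U * star (ent k l U))).re

/-- G -/
noncomputable def G (j l i k : Fin n) : ℝ := ∫ U, g j l i k U ∂μ

lemma F_int (j l i k : Fin n) : Integrable (fun U => ‖ent i j U‖ ^ 2 * ‖ent k l U‖ ^ 2) μ := by
  refine Integrable.of_bound (C := 1) ?_ (Filter.Eventually.of_forall fun U => ?_)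
  · exact (((ent_meas i j).norm.pow_const 2).mul ((ent_meas k l).norm.pow_const 2)).aestronglyMeasurable
  · rw [Real.norm_of_nonneg (by positivity)]
    exact mul_le_one₀ (pow_le_one₀ (norm_nonneg _) (ent_le _ _ _)) (by positivity)
      (pow_le_one₀ (norm_nonneg _) (ent_le _ _ _))

lemma E_int (i j : Fin n) : Integrable (fun U => ‖ent i j U‖ ^ 2) μ := by
  refine Integrable.of_bound (C := 1) ?_ (Filter.Eventually.of_forall fun U => ?_)
  · exact (((ent_meas i j).norm.pow_const 2)).aestronglyMeasurable
  · rw [Real.norm_of_nonneg (by positivity)]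
    exact (pow_le_one₀ (norm_nonneg _) (ent_le _ _ _))

lemma G_int (j l i k : Fin n) : Integrable (g j l i k) μ := by
  refine Integrable.of_bound (C := 1) ?_ (Filter.Eventually.of_forall fun U => ?_)
  · have m1 := ent_meas i j
    have m2 := ent_meas i l
    have m3 := ent_meas k j
    have m4 := ent_meas k l
    refine Measurable.aestronglyMeasurable ?_
    unfold g
    refine Complex.measurable_re.comp ?_
    exact (m1.mul (continuous_star.measurable.comp m2)).mul
      (continuous_star.measurable.comp (m3.mul (continuous_star.measurable.comp m4)))
  · rw [g, Real.norm_eq_abs]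
    refine (Complex.abs_re_le_norm _).trans ?_
    simp only [norm_mul, norm_star]
    exact mul_le_one₀ (mul_le_one₀ (ent_le _ _ _) (norm_nonneg _) (ent_le _ _ _)) (by positivity)
      (mul_le_one₀ (ent_le _ _ _) (norm_nonneg _) (ent_le _ _ _))

lemma F_perm (σ : Equiv.Perm (Fin n)) (j l i k : Fin n) : F μ j l (σ i) (σ k) = F μ j l i k := by
  have := integral_mul_left_eq_self (μ := μ) (fun U => ‖ent i j U‖ ^ 2 * ‖ent k l U‖ ^ 2) (permU σ)
  unfold F
  simpa only [ent_perm] using this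

lemma E_perm (σ : Equiv.Perm (Fin n)) (j i : Fin n) :
    ∫ U, ‖ent (σ i) j U‖ ^ 2 ∂μ = ∫ U, ‖ent i j U‖ ^ 2 ∂μ := by
  have := integral_mul_left_eq_self (μ := μ) (fun U => ‖ent i j U‖ ^ 2) (permU σ)
  simpa only [ent_perm] using this

lemma E_val (hn : 2 ≤ n) (i j : Fin n) : ∫ U, ‖ent i j U‖ ^ 2 ∂μ = 1 / n := by
  have h : ∑ k, ∫ U, ‖ent k j U‖ ^ 2 ∂μ = 1 := by
    rw [← integral_finsetSum _ fun k _ => E_int μ k j]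
    simp [ent_norm]
  have h2 : ∀ k, ∫ U, ‖ent k j U‖ ^ 2 ∂μ = ∫ U, ‖ent i j U‖ ^ 2 ∂μ := fun k => by
    have := E_perm μ (Equiv.swap i k) j i
    rwa [Equiv.swap_apply_left] at this
  simp only [h2, Finset.sum_const, Finset.card_univ, Fintype.card_fin, nsmul_eq_mul] at h
  have : (n : ℝ) ≠ 0 := by positivity
  field_simp
  linarith

lemma F_diag (j l i i' : Fin n) : F μ j l i i = F μ j l i' i' := by
  have := F_perm μ (Equiv.swap i' i) j l i' i'
  rwa [Equiv.swap_apply_left] at this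

lemma F_off (j l i k i' k' : Fin n) (h : i ≠ k) (h' : i' ≠ k') : F μ j l i k = F μ j l i' k' := by
  have h1 := F_perm μ (Equiv.swap i i') j l i k
  rw [Equiv.swap_apply_left] at h1
  rw [← h1]
  set m := Equiv.swap i i' k with hm
  have hne : m ≠ i' := by
    intro e
    have : Equiv.swap i i' k = Equiv.swap i i' i := by rw [← hm, e, Equiv.swap_apply_left]
    exact h ((Equiv.injective _ this).symm)
  have h2 := F_perm μ (Equiv.swap m k') j l i' m
  rw [Equiv.swap_apply_left, Equiv.swap_apply_of_ne_of_ne hne.symm h'] at h2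
  exact h2.symm

lemma G_diag (j l i : Fin n) : G μ j l i i = F μ j l i i := by
  unfold G F g
  congr 1; ext U
  have := Complex.mul_conj' (ent i j U * star (ent i l U))
  rw [← starRingEnd_apply (ent i j U * star (ent i l U)), this, norm_mul, norm_star]
  rw [← mul_pow]
  exact_mod_cast Complex.ofReal_re _

lemma ptwise (a b c d : ℂ) :
    ‖(1 + Complex.I) / 2 * a + (1 - Complex.I) / 2 * star 1 * b‖ ^ 2 *
      ‖(1 + Complex.I) / 2 * c + (1 - Complex.I) / 2 * star 1 * d‖ ^ 2 +
    ‖(1 + Complex.I) / 2 * a + (1 - Complex.I) / 2 * star (-1) * b‖ ^ 2 *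
      ‖(1 + Complex.I) / 2 * c + (1 - Complex.I) / 2 * star (-1) * d‖ ^ 2 +
    ‖(1 + Complex.I) / 2 * a + (1 - Complex.I) / 2 * star Complex.I * b‖ ^ 2 *
      ‖(1 + Complex.I) / 2 * c + (1 - Complex.I) / 2 * star Complex.I * d‖ ^ 2 +
    ‖(1 + Complex.I) / 2 * a + (1 - Complex.I) / 2 * star (-Complex.I) * b‖ ^ 2 *
      ‖(1 + Complex.I) / 2 * c + (1 - Complex.I) / 2 * star (-Complex.I) * d‖ ^ 2 =
    ‖a‖ ^ 2 * ‖c‖ ^ 2 + ‖a‖ ^ 2 * ‖d‖ ^ 2 + ‖b‖ ^ 2 * ‖c‖ ^ 2 + ‖b‖ ^ 2 * ‖d‖ ^ 2 +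
      2 * (a * star c * star (b * star d)).re := by
  simp only [← Complex.normSq_eq_norm_sq, Complex.normSq_apply]
  simp
  ring

lemma int4 {a b c d : Matrix.unitaryGroup (Fin n) ℂ → ℝ} (ha : Integrable a μ)
    (hb : Integrable b μ) (hc : Integrable c μ) (hd : Integrable d μ) :
    ∫ U, a U ∂μ + ∫ U, b U ∂μ + ∫ U, c U ∂μ + ∫ U, d U ∂μ = ∫ U, (a U + b U + c U + d U) ∂μ := by
  rw [integral_add (f := fun U => a U + b U + c U) ((ha.add hb).add hc) hd,
    integral_add (f := fun U => a U + b U) (ha.add hb) hc, integral_add ha hb]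

lemma FG (j l i k : Fin n) (h : i ≠ k) : F μ j l i i = F μ j l i k + G μ j l i k := by
  have key : ∀ ω : ℂ, ω * star ω = 1 → F μ j l i i = ∫ U,
      ‖(1 + Complex.I) / 2 * ent i j U + (1 - Complex.I) / 2 * star ω * ent k j U‖ ^ 2 *
      ‖(1 + Complex.I) / 2 * ent i l U + (1 - Complex.I) / 2 * star ω * ent k l U‖ ^ 2 ∂μ ∧
      Integrable (fun U =>
      ‖(1 + Complex.I) / 2 * ent i j U + (1 - Complex.I) / 2 * star ω * ent k j U‖ ^ 2 *
      ‖(1 + Complex.I) / 2 * ent i l U + (1 - Complex.I) / 2 * star ω * ent k l U‖ ^ 2) μ := by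
    intro ω hω
    have h1 := integral_mul_left_eq_self (μ := μ) (fun U => ‖ent i j U‖ ^ 2 * ‖ent i l U‖ ^ 2)
      ⟨mixM i k ω, mix_mem i k h ω hω⟩
    have h2 := (F_int μ j l i i).comp_mul_left ⟨mixM i k ω, mix_mem i k h ω hω⟩
    simp only [ent_mix i k h ω hω] at h1 h2
    exact ⟨h1.symm, h2⟩
  obtain ⟨e1, i1⟩ := key 1 (by simp)
  obtain ⟨e2, i2⟩ := key (-1) (by simp)
  obtain ⟨e3, i3⟩ := key Complex.I (by simp)
  obtain ⟨e4, i4⟩ := key (-Complex.I) (by simp)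
  have L : 4 * F μ j l i i = F μ j l i i + F μ j l i k + F μ j l k i + F μ j l k k
      + 2 * G μ j l i k := by
    have : 4 * F μ j l i i = F μ j l i i + F μ j l i i + F μ j l i i + F μ j l i i := by ring
    rw [this]
    nth_rw 1 [e1]
    nth_rw 1 [e2]
    nth_rw 1 [e3]
    nth_rw 1 [e4]
    rw [int4 μ i1 i2 i3 i4]
    have j1 := F_int μ j l i i
    have j2 := F_int μ j l i k
    have j3 := F_int μ j l k i
    have j4 := F_int μ j l k k
    have j5 := (G_int μ j l i k).const_mul 2
    unfold F G
    rw [← integral_const_mul, int4 μ j1 j2 j3 j4]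
    refine Eq.trans ?_ (integral_add (((j1.add j2).add j3).add j4) j5)
    congr 1; ext U
    have := ptwise (ent i j U) (ent k j U) (ent i l U) (ent k l U)
    exact this
  rw [F_diag μ j l k i, F_off μ j l k i i k h.symm h] at L
  linarith

lemma F_sum (j l : Fin n) : ∑ i, ∑ k, F μ j l i k = 1 := by
  unfold F
  have : ∀ i, ∑ k, ∫ U, ‖ent i j U‖ ^ 2 * ‖ent k l U‖ ^ 2 ∂μ = ∫ U, ‖ent i j U‖ ^ 2 ∂μ := by
    intro i
    rw [← integral_finsetSum _ fun k _ => F_int μ j l i k]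
    simp only [← Finset.mul_sum, ent_norm, mul_one]
  simp only [this]
  rw [← integral_finsetSum _ fun k _ => E_int μ k j]
  simp [ent_norm]

lemma G_sum (j l : Fin n) : ∑ i, ∑ k, G μ j l i k = if j = l then 1 else 0 := by
  unfold G
  have : ∀ i, ∑ k, ∫ U, g j l i k U ∂μ = ∫ U, ∑ k, g j l i k U ∂μ := by
    intro i
    rw [← integral_finsetSum _ fun k _ => G_int μ j l i k]
  simp only [this]
  rw [← integral_finsetSum _ fun i _ => integrable_finsetSum _ fun k _ => G_int μ j l i k]
  have h : ∀ U, ∑ i, ∑ k, g j l i k U = if j = l then 1 else 0 := by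
    intro U
    unfold g
    simp only [← Complex.re_sum, ← Finset.mul_sum, ← star_sum, ← Finset.sum_mul, ent_orth]
    split_ifs <;> simp
  simp [h]

lemma sum_split (f : Fin n → Fin n → ℝ) (c d : ℝ) (hc : ∀ i, f i i = c)
    (hd : ∀ i k, i ≠ k → f i k = d) : ∑ i, ∑ k, f i k = n * c + n * (n - 1) * d := by
  have : ∀ i k, f i k = d + if i = k then c - d else 0 := by
    intro i k
    split_ifs with h
    · subst h; rw [hc]; ring
    · rw [hd i k h]; ring
  simp only [this, Finset.sum_add_distrib]
  simp
  ring

lemma F_val (hn : 2 ≤ n) (j l i k : Fin n) : F μ j l i k =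
    (1 + (if i = k then 1 else 0) * (if j = l then 1 else 0) - (if j = l then 1 else 0) / n
      - (if i = k then 1 else 0) / n) / ((n : ℝ) ^ 2 - 1) := by
  have hn' : (2 : ℝ) ≤ n := by exact_mod_cast hn
  let i0 : Fin n := ⟨0, by omega⟩
  let i1 : Fin n := ⟨1, by omega⟩
  have h01 : i0 ≠ i1 := by simp [i0, i1]
  have S1 := F_sum μ j l
  have S2 := G_sum μ j l
  rw [sum_split _ (F μ j l i0 i0) (F μ j l i0 i1) (fun i => F_diag μ j l _ _)
    (fun i k h => F_off μ j l _ _ _ _ h h01)] at S1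
  rw [sum_split _ (F μ j l i0 i0) (F μ j l i0 i0 - F μ j l i0 i1)
    (fun i => by rw [G_diag]; exact F_diag μ j l _ _)
    (fun i k h => by rw [F_diag μ j l i0 i, FG μ j l i k h, F_off μ j l i0 i1 i k h01 h]; ring)] at S2
  generalize (if j = l then (1 : ℝ) else 0) = δ at *
  have hc : F μ j l i0 i0 = (1 + δ) / (n * (n + 1)) := by
    rw [eq_div_iff (by positivity)]; linarith
  have h1 : (n : ℝ) - 1 ≠ 0 := by linarith
  have h2 : (n : ℝ) + 1 ≠ 0 := by linarith
  have h3 : (n : ℝ) ≠ 0 := by linarith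
  have h4 : (n : ℝ) ^ 2 - 1 ≠ 0 := by
    rw [show (n : ℝ) ^ 2 - 1 = (n - 1) * (n + 1) by ring]; exact mul_ne_zero h1 h2
  split_ifs with h
  · subst h
    rw [F_diag μ j l i i0, hc]
    field_simp
    ring
  · rw [F_off μ j l i k i0 i1 h h01]
    rw [hc] at S1
    have : F μ j l i0 i1 = (1 - n * ((1 + δ) / (n * (n + 1)))) / (n * (n - 1)) := by
      rw [eq_div_iff (mul_ne_zero h3 h1)]; linarith
    rw [this]
    field_simp
    ring
end

lemma T_eq {n p q : ℕ} (U) : truncTraceU n p q U = ∑ i : Fin n, ∑ j : Fin n,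
    ((if (i : ℕ) < p then 1 else 0) * (if (j : ℕ) < q then 1 else 0)) * ‖ent i j U‖ ^ 2 := by
  unfold truncTraceU ent
  refine Finset.sum_congr rfl fun i _ => Finset.sum_congr rfl fun j _ => ?_
  by_cases h1 : (i : ℕ) < p <;> by_cases h2 : (j : ℕ) < q <;> simp [h1, h2]

lemma ind_sum {n p : ℕ} (h : p ≤ n) : ∑ i : Fin n, (if (i : ℕ) < p then (1 : ℝ) else 0) = p := by
  rw [Fin.sum_univ_eq_sum_range (fun i => if i < p then (1 : ℝ) else 0) n, ← Finset.sum_filter]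
  have : (Finset.range n).filter (fun i => i < p) = Finset.range p := by ext; simp; omega
  rw [this]; simp

lemma ind_sum2 {n p p' : ℕ} (h : p ≤ n) : ∑ i : Fin n, ∑ k : Fin n,
    (if (i : ℕ) < p then (1 : ℝ) else 0) * (if (k : ℕ) < p' then (1 : ℝ) else 0) *
      (if i = k then 1 else 0) = min (p : ℝ) p' := by
  rw [← Nat.cast_min, ← ind_sum (n := n) (p := min p p') (by omega)]
  refine Finset.sum_congr rfl fun i _ => ?_
  simp only [mul_ite, mul_one, mul_zero, Finset.sum_ite_eq, Finset.mem_univ, if_true, lt_min_iff]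
  by_cases h1 : (i : ℕ) < p <;> by_cases h2 : (i : ℕ) < p' <;> simp [h1, h2]

lemma sum_expand {n : ℕ} (a a' b b' : Fin n → ℝ) (e : Fin n → Fin n → ℝ) (N D : ℝ) :
    ∑ i, ∑ k, ∑ j, ∑ l, ((a i * b j) * (a' k * b' l)) *
      ((1 + e i k * e j l - e j l / N - e i k / N) / D) =
    ((∑ i, a i) * (∑ i, a' i) * ((∑ i, b i) * (∑ i, b' i))
      + (∑ i, ∑ k, a i * a' k * e i k) * (∑ i, ∑ k, b i * b' k * e i k)
      - (∑ i, a i) * (∑ i, a' i) * (∑ i, ∑ k, b i * b' k * e i k) / N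
      - (∑ i, ∑ k, a i * a' k * e i k) * ((∑ i, b i) * (∑ i, b' i)) / N) / D := by
  have inner : ∀ i k, ∑ j, ∑ l, ((a i * b j) * (a' k * b' l)) *
      ((1 + e i k * e j l - e j l / N - e i k / N) / D) =
      (a i * a' k * ((∑ i, b i) * (∑ i, b' i))
      + a i * a' k * e i k * (∑ i, ∑ k, b i * b' k * e i k)
      - a i * a' k * (∑ i, ∑ k, b i * b' k * e i k) / N
      - a i * a' k * e i k * ((∑ i, b i) * (∑ i, b' i)) / N) / D := by
    intro i k
    rw [Finset.sum_mul_sum]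
    simp only [Finset.mul_sum, Finset.sum_div, ← Finset.sum_add_distrib, ← Finset.sum_sub_distrib]
    refine Finset.sum_congr rfl fun j _ => Finset.sum_congr rfl fun l _ => ?_
    ring
  simp only [inner]
  generalize (∑ i, ∑ k, b i * b' k * e i k) = X
  generalize ((∑ i, b i) * (∑ i, b' i)) = Y
  rw [Finset.sum_mul_sum]
  simp only [Finset.sum_mul, Finset.sum_div, ← Finset.sum_add_distrib, ← Finset.sum_sub_distrib]

end CovAux

/-- If `U` is Haar distributed on `U(n)` with `n ≥ 2`, then for all
`1 ≤ p, p', q, q' ≤ n`,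
`Cov(T_{p,q}, T_{p',q'}) = (p∧p')(q∧q')/(n²-1) - (p∧p')qq'/(n(n²-1))
  - pp'(q∧q')/(n(n²-1)) + pp'qq'/(n²(n²-1))`,
where `Cov(X, Y) = E[XY] - E[X]E[Y]`. -/
theorem covariance_truncTraceU (n : ℕ) (hn : 2 ≤ n)
    (μ : Measure (Matrix.unitaryGroup (Fin n) ℂ))
    [μ.IsHaarMeasure] [IsProbabilityMeasure μ]
    (p p' q q' : ℕ) (hp1 : 1 ≤ p) (hpn : p ≤ n) (hp'1 : 1 ≤ p') (hp'n : p' ≤ n)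
    (hq1 : 1 ≤ q) (hqn : q ≤ n) (hq'1 : 1 ≤ q') (hq'n : q' ≤ n) :
    (∫ U, truncTraceU n p q U * truncTraceU n p' q' U ∂μ) -
      (∫ U, truncTraceU n p q U ∂μ) * (∫ U, truncTraceU n p' q' U ∂μ) =
    (min p p' : ℝ) * (min q q' : ℝ) / ((n : ℝ) ^ 2 - 1)
      - (min p p' : ℝ) * q * q' / ((n : ℝ) * ((n : ℝ) ^ 2 - 1))
      - (p : ℝ) * p' * (min q q' : ℝ) / ((n : ℝ) * ((n : ℝ) ^ 2 - 1))
      + (p : ℝ) * p' * q * q' / ((n : ℝ) ^ 2 * ((n : ℝ) ^ 2 - 1)) := by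
  classical
  have hT : ∀ p q : ℕ, p ≤ n → q ≤ n → ∫ U, truncTraceU n p q U ∂μ = (p : ℝ) * q / n := by
    intro p q hp hq
    simp only [CovAux.T_eq]
    rw [integral_finsetSum _ fun i _ => integrable_finsetSum _ fun j _ => (CovAux.E_int μ i j).const_mul _]
    have : ∀ i : Fin n, ∫ U, ∑ j : Fin n, ((if (i : ℕ) < p then (1 : ℝ) else 0) *
        (if (j : ℕ) < q then 1 else 0)) * ‖CovAux.ent i j U‖ ^ 2 ∂μ =
        ∑ j : Fin n, ((if (i : ℕ) < p then (1 : ℝ) else 0) *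
        (if (j : ℕ) < q then 1 else 0)) * (1 / n) := by
      intro i
      rw [integral_finsetSum _ fun j _ => (CovAux.E_int μ i j).const_mul _]
      refine Finset.sum_congr rfl fun j _ => ?_
      rw [integral_const_mul, CovAux.E_val μ hn]
    simp only [this, ← Finset.sum_mul, ← Finset.mul_sum]
    rw [CovAux.ind_sum hp, CovAux.ind_sum hq]; ring
  have hTT : ∫ U, truncTraceU n p q U * truncTraceU n p' q' U ∂μ =
      ∑ i : Fin n, ∑ k : Fin n, ∑ j : Fin n, ∑ l : Fin n,
      (((if (i : ℕ) < p then (1 : ℝ) else 0) * (if (j : ℕ) < q then 1 else 0)) *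
      ((if (k : ℕ) < p' then 1 else 0) * (if (l : ℕ) < q' then 1 else 0))) *
      CovAux.F μ j l i k := by
    have e : ∀ U, truncTraceU n p q U * truncTraceU n p' q' U =
      ∑ i : Fin n, ∑ k : Fin n, ∑ j : Fin n, ∑ l : Fin n,
      (((if (i : ℕ) < p then (1 : ℝ) else 0) * (if (j : ℕ) < q then 1 else 0)) *
      ((if (k : ℕ) < p' then 1 else 0) * (if (l : ℕ) < q' then 1 else 0))) *
      (‖CovAux.ent i j U‖ ^ 2 * ‖CovAux.ent k l U‖ ^ 2) := by
      intro U
      rw [CovAux.T_eq, CovAux.T_eq, Finset.sum_mul_sum]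
      refine Finset.sum_congr rfl fun i _ => Finset.sum_congr rfl fun k _ => ?_
      rw [Finset.sum_mul_sum]
      refine Finset.sum_congr rfl fun j _ => Finset.sum_congr rfl fun l _ => ?_
      ring
    simp only [e]
    have I := fun (c : ℝ) (j l i k : Fin n) => (CovAux.F_int μ j l i k).const_mul c
    rw [integral_finsetSum _ fun i _ => integrable_finsetSum _ fun k _ =>
      integrable_finsetSum _ fun j _ => integrable_finsetSum _ fun l _ => I _ j l i k]
    refine Finset.sum_congr rfl fun i _ => ?_
    rw [integral_finsetSum _ fun k _ =>
      integrable_finsetSum _ fun j _ => integrable_finsetSum _ fun l _ => I _ j l i k]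
    refine Finset.sum_congr rfl fun k _ => ?_
    rw [integral_finsetSum _ fun j _ => integrable_finsetSum _ fun l _ => I _ j l i k]
    refine Finset.sum_congr rfl fun j _ => ?_
    rw [integral_finsetSum _ fun l _ => I _ j l i k]
    refine Finset.sum_congr rfl fun l _ => ?_
    rw [integral_const_mul]; rfl
  have hval : ∫ U, truncTraceU n p q U * truncTraceU n p' q' U ∂μ =
      ((p : ℝ) * p' * (q * q') + min (p : ℝ) p' * min (q : ℝ) q' - p * p' * min (q : ℝ) q' / n
        - min (p : ℝ) p' * (q * q') / n) / ((n : ℝ) ^ 2 - 1) := by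
    rw [hTT, ← CovAux.ind_sum2 (p' := p') hpn, ← CovAux.ind_sum2 (p' := q') hqn,
      ← CovAux.ind_sum hpn, ← CovAux.ind_sum hp'n, ← CovAux.ind_sum hqn, ← CovAux.ind_sum hq'n]
    simp only [CovAux.F_val μ hn]
    exact CovAux.sum_expand (n := n) _ _ _ _ (fun i k => if i = k then 1 else 0) _ _
  have hn' : (2 : ℝ) ≤ n := by exact_mod_cast hn
  have h3 : (n : ℝ) ≠ 0 := by linarith
  have h4 : (n : ℝ) ^ 2 - 1 ≠ 0 := by nlinarith
  rw [hval, hT p q hpn hqn, hT p' q' hp'n hq'n]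
  field_simp
  ring
end

section
/- There exists a constant C > 0 such that for every n ≥ 2 and all 1 ≤ p, q ≤ n, if U is distributed according to the Haar probability measure on the unitary group U(n) and T_{p,q} = Σ_{i≤p, j≤q} |U_{ij}|², then E[(T_{p,q} − pq/n)^4] ≤ C p² q² / n⁴. -/
open MeasureTheory Matrix

namespace FMB

abbrev UG (n : ℕ) := Matrix.unitaryGroup (Fin n) ℂ

theorem borelU (n : ℕ) : BorelSpace (UG n) := by
  have : BorelSpace (Matrix (Fin n) (Fin n) ℂ) := inferInstanceAs (BorelSpace (Fin n → Fin n → ℂ))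
  exact Subtype.borelSpace _

theorem compactU (n : ℕ) : CompactSpace (UG n) := by
  apply isCompact_iff_compactSpace.mp
  have hK : IsCompact (Set.univ.pi fun _ : Fin n => Set.univ.pi fun _ : Fin n =>
      Metric.closedBall (0 : ℂ) 1) :=
    isCompact_univ_pi fun _ => isCompact_univ_pi fun _ => isCompact_closedBall _ _
  refine IsCompact.of_isClosed_subset (X := Matrix (Fin n) (Fin n) ℂ) hK ?_ ?_
  · have : ((Matrix.unitaryGroup (Fin n) ℂ : Set (Matrix (Fin n) (Fin n) ℂ)))
        = {A | A * star A = 1} := by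
      ext A; exact Matrix.mem_unitaryGroup_iff
    rw [this]
    exact isClosed_eq (by fun_prop) continuous_const
  · intro A hA
    change ∀ i ∈ Set.univ, ∀ j ∈ Set.univ, A i j ∈ Metric.closedBall (0 : ℂ) 1
    intro i _ j _
    exact mem_closedBall_zero_iff.mpr (entry_norm_bound_of_unitary hA i j)

theorem integrable_cont {n : ℕ} {E : Type*} [NormedAddCommGroup E] [SecondCountableTopology E]
    (μ : Measure (UG n)) [IsProbabilityMeasure μ]
    {g : UG n → E} (hg : Continuous g) : Integrable g μ := by
  have := borelU n
  have := compactU n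
  exact hg.integrable_of_hasCompactSupport (HasCompactSupport.of_compactSpace g)

theorem int_deriv_zero {n : ℕ} (μ : Measure (UG n)) [IsProbabilityMeasure μ] [μ.IsMulLeftInvariant]
    (g g' : UG n → ℂ) (hg : Continuous g) (hg' : Continuous g') (V : ℝ → UG n) (hV0 : V 0 = 1)
    (hd : ∀ t U, HasDerivAt (fun t => g (V t * U)) (g' (V t * U)) t) :
    ∫ U, g' U ∂μ = 0 := by
  have := borelU n
  have := compactU n
  obtain ⟨C, hC⟩ := isCompact_univ.exists_bound_of_continuousOn (f := g') hg'.continuousOn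
  have key := hasDerivAt_integral_of_dominated_loc_of_deriv_le (μ := μ) (𝕜 := ℝ)
    (F := fun t U => g (V t * U)) (F' := fun t U => g' (V t * U)) (x₀ := 0) (s := Set.univ)
    (bound := fun _ => C) Filter.univ_mem
    (Filter.Eventually.of_forall fun t =>
      (integrable_cont μ (hg.comp (continuous_const_mul (V t)))).aestronglyMeasurable)
    (integrable_cont μ (hg.comp (continuous_const_mul (V 0))))
    (integrable_cont μ (hg'.comp (continuous_const_mul (V 0)))).aestronglyMeasurable
    (Filter.Eventually.of_forall fun U t _ => hC _ (Set.mem_univ _))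
    (integrable_const C)
    (Filter.Eventually.of_forall fun U t _ => hd t U)
  have h2 := key.2
  simp only [integral_mul_left_eq_self, hV0, one_mul] at h2
  exact h2.unique (hasDerivAt_const _ _)

section
open scoped Matrix.Norms.L2Operator

theorem exists_curve {n : ℕ} (Z : Matrix (Fin n) (Fin n) ℂ) (hZ : star Z = -Z) :
    ∃ V : ℝ → UG n, V 0 = 1 ∧ ∀ t (B : Matrix (Fin n) (Fin n) ℂ),
      HasDerivAt (fun t => (V t : Matrix (Fin n) (Fin n) ℂ) * B * star (V t : Matrix (Fin n) (Fin n) ℂ))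
       (Z * ((V t : Matrix (Fin n) (Fin n) ℂ) * B * star (V t : Matrix (Fin n) (Fin n) ℂ))
        - ((V t : Matrix (Fin n) (Fin n) ℂ) * B * star (V t : Matrix (Fin n) (Fin n) ℂ)) * Z) t := by
  have hs : ∀ t : ℝ, t • Z ∈ skewAdjoint (Matrix (Fin n) (Fin n) ℂ) := by
    intro t
    rw [skewAdjoint.mem_iff, star_smul, hZ]; simp
  let _ : NormedAlgebra ℚ (Matrix (Fin n) (Fin n) ℂ) := NormedAlgebra.restrictScalars ℚ ℂ _
  refine ⟨fun t => ⟨NormedSpace.exp (t • Z),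
    NormedSpace.exp_mem_unitary_of_mem_skewAdjoint (hs t)⟩, ?_, ?_⟩
  · apply Subtype.ext; simp
  · intro t B
    have h1 := hasDerivAt_exp_smul_const' (𝕂 := ℝ) Z t
    have h2 := (h1.mul_const B).mul h1.star
    have e : (Z * (NormedSpace.exp (t • Z) * B * star (NormedSpace.exp (t • Z)))
        - (NormedSpace.exp (t • Z) * B * star (NormedSpace.exp (t • Z))) * Z) =
      Z * NormedSpace.exp (t • Z) * B * star (NormedSpace.exp (t • Z)) +
        NormedSpace.exp (t • Z) * B * star (Z * NormedSpace.exp (t • Z)) := by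
      simp only [star_mul, hZ]
      noncomm_ring
    exact e ▸ h2
end

variable {n : ℕ}

/-- The conjugated matrix. -/
noncomputable def B (Q : Matrix (Fin n) (Fin n) ℂ) (U : UG n) : Matrix (Fin n) (Fin n) ℂ :=
  (U : Matrix (Fin n) (Fin n) ℂ) * Q * star (U : Matrix (Fin n) (Fin n) ℂ)

theorem continuous_B (Q : Matrix (Fin n) (Fin n) ℂ) : Continuous (B Q) := by
  unfold B; fun_prop

theorem B_mul (Q : Matrix (Fin n) (Fin n) ℂ) (V U : UG n) :
    B Q (V * U) = (V : Matrix (Fin n) (Fin n) ℂ) * B Q U * star (V : Matrix (Fin n) (Fin n) ℂ) := by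
  simp [B, mul_assoc]

open scoped Matrix.Norms.L2Operator in
theorem hasDerivAt_trace_mul (A : Matrix (Fin n) (Fin n) ℂ) {F : ℝ → Matrix (Fin n) (Fin n) ℂ}
    {F' : Matrix (Fin n) (Fin n) ℂ} {t : ℝ} (h : HasDerivAt F F' t) :
    HasDerivAt (fun t => trace (A * F t)) (trace (A * F')) t := by
  let L : Matrix (Fin n) (Fin n) ℂ →ₗ[ℝ] ℂ :=
    (Matrix.traceLinearMap (Fin n) ℝ ℂ).comp (LinearMap.mulLeft ℝ A)
  have hL : Continuous L := by
    change Continuous fun X => trace (A * X)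
    fun_prop
  exact (ContinuousLinearMap.mk L hL).hasFDerivAt.comp_hasDerivAt t h

theorem ibp_skew (μ : Measure (UG n)) [IsProbabilityMeasure μ] [μ.IsMulLeftInvariant]
    (P Q : Matrix (Fin n) (Fin n) ℂ) (c : ℂ) (k : ℕ) (Z W : Matrix (Fin n) (Fin n) ℂ)
    (hZ : star Z = -Z) :
    ∫ U, (k * (trace (P * B Q U) - c) ^ (k - 1) * trace (P * (Z * B Q U - B Q U * Z))
        * trace ((P * W - W * P) * B Q U)
      + (trace (P * B Q U) - c) ^ k * trace ((P * W - W * P) * (Z * B Q U - B Q U * Z))) ∂μ = 0 := by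
  obtain ⟨V, hV0, hV⟩ := exists_curve Z hZ
  have hB := continuous_B Q
  refine int_deriv_zero μ (fun U => (trace (P * B Q U) - c) ^ k * trace ((P * W - W * P) * B Q U))
    _ (by fun_prop) (by fun_prop) V hV0 ?_
  intro t U
  have h := hV t (B Q U)
  simp only [B_mul]
  have h1 := ((hasDerivAt_trace_mul P h).sub_const c).pow k
  exact h1.mul (hasDerivAt_trace_mul (P * W - W * P) h)

theorem ibp (μ : Measure (UG n)) [IsProbabilityMeasure μ] [μ.IsMulLeftInvariant]
    (P Q : Matrix (Fin n) (Fin n) ℂ) (c : ℂ) (k : ℕ) (Z W : Matrix (Fin n) (Fin n) ℂ) :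
    ∫ U, (k * (trace (P * B Q U) - c) ^ (k - 1) * trace (P * (Z * B Q U - B Q U * Z))
        * trace ((P * W - W * P) * B Q U)
      + (trace (P * B Q U) - c) ^ k * trace ((P * W - W * P) * (Z * B Q U - B Q U * Z))) ∂μ = 0 := by
  have hB := continuous_B Q
  have h1 := ibp_skew μ P Q c k ((1 / 2 : ℂ) • (Z - star Z)) W (by
    simp [star_smul]; rw [← smul_neg]; simp)
  have h2 := ibp_skew μ P Q c k ((-Complex.I / 2 : ℂ) • (Z + star Z)) W (by
    rw [star_smul, ← neg_smul]; simp [add_comm, neg_div])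
  have h3 : ∀ X : ℂ, X = 0 → Complex.I * X = 0 := by rintro _ rfl; simp
  have h4 := h3 _ h2
  rw [← integral_const_mul] at h4
  have h5 := congrArg₂ (· + ·) h1 h4
  simp only [add_zero] at h5
  rw [← integral_add (integrable_cont μ (by fun_prop)) (integrable_cont μ (by fun_prop))] at h5
  rw [← h5]
  congr 1
  ext U
  have hz : ∀ A : Matrix (Fin n) (Fin n) ℂ, trace (A * (Z * B Q U - B Q U * Z)) =
      trace (A * (((1 / 2 : ℂ) • (Z - star Z)) * B Q U - B Q U * ((1 / 2 : ℂ) • (Z - star Z))))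
      + Complex.I * trace (A * (((-Complex.I / 2 : ℂ) • (Z + star Z)) * B Q U
          - B Q U * ((-Complex.I / 2 : ℂ) • (Z + star Z)))) := by
    intro A
    simp only [smul_mul_assoc, mul_smul_comm, ← smul_sub, trace_smul, smul_eq_mul]
    have : Complex.I * (-Complex.I / 2 * trace (A * ((Z + star Z) * B Q U - B Q U * (Z + star Z))))
      = 1 / 2 * trace (A * ((Z + star Z) * B Q U - B Q U * (Z + star Z))) := by
      linear_combination (-1 / 2 * trace (A * ((Z + star Z) * B Q U - B Q U * (Z + star Z)))) * Complex.I_sq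
    rw [this, ← mul_add, ← trace_add, ← mul_add]
    have : ((Z - star Z) * B Q U - B Q U * (Z - star Z) + ((Z + star Z) * B Q U - B Q U * (Z + star Z)))
      = (2 : ℂ) • (Z * B Q U - B Q U * Z) := by
      rw [two_smul]; noncomm_ring
    rw [this, mul_smul_comm, trace_smul, smul_eq_mul]; ring
  rw [hz P, hz (P * W - W * P)]
  ring

theorem sum_tr_tr (M N : Matrix (Fin n) (Fin n) ℂ) :
    ∑ a, ∑ b, trace (M * single a b 1) * trace (N * single b a 1) = trace (M * N) := by
  simp only [trace_mul_single]
  rw [Finset.sum_comm]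
  simp [trace, mul_apply]

theorem sum_tr2 (M N : Matrix (Fin n) (Fin n) ℂ) :
    ∑ a, ∑ b, trace (M * single a b 1 * N * single b a 1) = trace M * trace N := by
  have : ∀ a b, trace (M * single a b 1 * N * single b a 1) = M a a * N b b := by
    intro a b
    rw [trace_mul_comm, ← mul_assoc, ← mul_assoc, trace_mul_comm, trace_mul_comm,
      mul_assoc, mul_assoc]
    rw [trace_mul_comm, trace_mul_single]
    simp [mul_apply, single_apply, Finset.sum_ite, ite_and]
  simp only [this]
  simp only [trace, diag, Finset.sum_mul_sum]

theorem casimir1 (P X : Matrix (Fin n) (Fin n) ℂ) :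
    ∑ a, ∑ b, trace (P * (single a b 1 * X - X * single a b 1))
      * trace ((P * single b a 1 - single b a 1 * P) * X)
     = 2 * trace (X * P * X * P) - 2 * trace (P * P * (X * X)) := by
  have h1 : ∀ Z : Matrix (Fin n) (Fin n) ℂ, trace (P * (Z * X - X * Z))
      = trace ((X * P - P * X) * Z) := by
    intro Z
    rw [mul_sub, sub_mul, trace_sub, trace_sub, ← mul_assoc, trace_mul_comm (P * Z) X]
    simp only [mul_assoc]
  have h2 : ∀ Z : Matrix (Fin n) (Fin n) ℂ, trace ((P * Z - Z * P) * X)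
      = trace ((X * P - P * X) * Z) := by
    intro Z
    rw [sub_mul, sub_mul, trace_sub, trace_sub, trace_mul_comm (P * Z) X, mul_assoc Z,
      trace_mul_comm Z]
    simp only [mul_assoc]
  simp only [h1, h2, sum_tr_tr]
  have e : (X * P - P * X) * (X * P - P * X)
    = X * P * X * P - X * (P * P * X) - P * X * X * P + P * X * P * X := by noncomm_ring
  rw [e, trace_add, trace_sub, trace_sub, trace_mul_comm X (P * P * X),
    trace_mul_comm (P * X * X) P, mul_assoc P X P, mul_assoc P (X * P) X, trace_mul_comm P (X * P * X)]
  simp only [mul_assoc]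
  ring

theorem casimir2 (P X : Matrix (Fin n) (Fin n) ℂ) :
    ∑ a, ∑ b, trace ((P * single b a 1 - single b a 1 * P) *
        (single a b 1 * X - X * single a b 1))
     = 2 * n * trace (P * X) - 2 * (trace P * trace X) := by
  have h1 : ∀ Z W : Matrix (Fin n) (Fin n) ℂ, trace ((P * W - W * P) * (Z * X - X * Z))
      = trace ((X * P) * W * 1 * Z) - trace (P * W * X * Z) - trace (X * W * P * Z)
       + trace (1 * W * (P * X) * Z) := by
    intro Z W
    have e : (P * W - W * P) * (Z * X - X * Z)
      = P * W * Z * X - P * W * X * Z - W * P * Z * X + 1 * W * (P * X) * Z := by noncomm_ring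
    rw [e, trace_add, trace_sub, trace_sub, trace_mul_comm (P * W * Z) X,
      trace_mul_comm (W * P * Z) X]
    simp only [mul_assoc, one_mul]
  simp only [h1]
  rw [Finset.sum_comm]
  simp only [Finset.sum_add_distrib, Finset.sum_sub_distrib, sum_tr2]
  rw [trace_mul_comm X P]
  simp
  ring

theorem ibp_sum (μ : Measure (UG n)) [IsProbabilityMeasure μ] [μ.IsMulLeftInvariant]
    (P Q : Matrix (Fin n) (Fin n) ℂ) (c : ℂ) (k : ℕ) :
    ∫ U, (k * (trace (P * B Q U) - c) ^ (k - 1) *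
        (2 * trace (B Q U * P * B Q U * P) - 2 * trace (P * P * (B Q U * B Q U)))
      + (trace (P * B Q U) - c) ^ k *
        (2 * n * trace (P * B Q U) - 2 * (trace P * trace (B Q U)))) ∂μ = 0 := by
  have hB := continuous_B Q
  have h : ∑ a, ∑ b, ∫ U, (k * (trace (P * B Q U) - c) ^ (k - 1) *
      trace (P * (single a b 1 * B Q U - B Q U * single a b 1))
        * trace ((P * single b a 1 - single b a 1 * P) * B Q U)
      + (trace (P * B Q U) - c) ^ k * trace ((P * single b a 1 - single b a 1 * P)
        * (single a b 1 * B Q U - B Q U * single a b 1))) ∂μ = 0 := by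
    simp only [ibp]; simp
  rw [← h]
  have : ∀ a : Fin n, ∑ b, ∫ U, (k * (trace (P * B Q U) - c) ^ (k - 1) *
      trace (P * (single a b 1 * B Q U - B Q U * single a b 1))
        * trace ((P * single b a 1 - single b a 1 * P) * B Q U)
      + (trace (P * B Q U) - c) ^ k * trace ((P * single b a 1 - single b a 1 * P)
        * (single a b 1 * B Q U - B Q U * single a b 1))) ∂μ =
      ∫ U, ∑ b, (k * (trace (P * B Q U) - c) ^ (k - 1) *
      trace (P * (single a b 1 * B Q U - B Q U * single a b 1))
        * trace ((P * single b a 1 - single b a 1 * P) * B Q U)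
      + (trace (P * B Q U) - c) ^ k * trace ((P * single b a 1 - single b a 1 * P)
        * (single a b 1 * B Q U - B Q U * single a b 1))) ∂μ := by
    intro a
    rw [integral_finsetSum]
    intro b _
    exact integrable_cont μ (by fun_prop)
  simp only [this]
  rw [← integral_finsetSum]
  · congr 1
    ext U
    simp only [Finset.sum_add_distrib, mul_assoc _ (trace (P * _)), ← Finset.mul_sum]
    rw [casimir1, casimir2]
  · intro a _
    exact integrable_cont μ (by fun_prop)

/-- The coordinate projection. -/
noncomputable def Pr (n p : ℕ) : Matrix (Fin n) (Fin n) ℂ :=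
  diagonal fun i => if (i : ℕ) < p then 1 else 0

theorem Pr_sq (p : ℕ) : Pr n p * Pr n p = Pr n p := by
  simp [Pr, diagonal_mul_diagonal]

theorem Pr_star (p : ℕ) : star (Pr n p) = Pr n p := by
  rw [star_eq_conjTranspose, Pr, diagonal_conjTranspose]
  congr 1; ext i; simp [apply_ite]

theorem Pr_trace {p : ℕ} (hp : p ≤ n) : trace (Pr n p) = p := by
  simp only [Pr, trace_diagonal]
  rw [Fin.sum_univ_eq_sum_range (fun i => if i < p then (1 : ℂ) else 0)]
  simp only [Finset.sum_ite, Finset.sum_const, Finset.sum_const_zero]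
  have : (Finset.range n).filter (· < p) = Finset.range p := by
    ext i; simp; omega
  simp [this]

theorem B_sq (q : ℕ) (U : UG n) : B (Pr n q) U * B (Pr n q) U = B (Pr n q) U := by
  have hU : star (U : Matrix (Fin n) (Fin n) ℂ) * U = 1 := Matrix.mem_unitaryGroup_iff'.mp U.2
  calc B (Pr n q) U * B (Pr n q) U
      = (U : Matrix (Fin n) (Fin n) ℂ) * Pr n q * (star (U : Matrix (Fin n) (Fin n) ℂ) * U) * Pr n q
        * star (U : Matrix (Fin n) (Fin n) ℂ) := by simp only [B, mul_assoc]
    _ = _ := by rw [hU, mul_one, mul_assoc (U : Matrix (Fin n) (Fin n) ℂ), Pr_sq]; rfl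

theorem B_star (q : ℕ) (U : UG n) : star (B (Pr n q) U) = B (Pr n q) U := by
  simp [B, Pr_star, mul_assoc]

theorem B_trace (Q : Matrix (Fin n) (Fin n) ℂ) (U : UG n) : trace (B Q U) = trace Q := by
  have hU : star (U : Matrix (Fin n) (Fin n) ℂ) * U = 1 := Matrix.mem_unitaryGroup_iff'.mp U.2
  rw [B, trace_mul_comm, ← mul_assoc, hU, one_mul]

theorem trace_PB (p q : ℕ) (U : UG n) :
    trace (Pr n p * B (Pr n q) U) = (truncTraceU n p q U : ℂ) := by
  have e : ∀ i, (Pr n p * B (Pr n q) U) i i = (if (i : ℕ) < p then 1 else 0) *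
      ∑ j, (U : Matrix (Fin n) (Fin n) ℂ) i j * (if (j : ℕ) < q then 1 else 0)
        * star ((U : Matrix (Fin n) (Fin n) ℂ) i j) := by
    intro i
    rw [Pr, diagonal_mul, B, mul_apply]
    congr 1
    refine Finset.sum_congr rfl fun j _ => ?_
    rw [Pr, mul_diagonal, star_apply]
  simp only [truncTraceU, trace, diag, e]
  push_cast
  refine Finset.sum_congr rfl fun i _ => ?_
  rw [Finset.mul_sum]
  refine Finset.sum_congr rfl fun j _ => ?_
  by_cases hi : (i : ℕ) < p <;> by_cases hj : (j : ℕ) < q <;>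
    simp [hi, hj, Complex.mul_conj, Complex.normSq_eq_norm_sq, star_apply]

/-- The correction term. -/
noncomputable def S (n p q : ℕ) (U : UG n) : ℝ :=
  ∑ i, ∑ j, ‖(Pr n p * B (Pr n q) U * Pr n p) i j‖ ^ 2

theorem trace_BPBP (p q : ℕ) (U : UG n) :
    trace (B (Pr n q) U * Pr n p * B (Pr n q) U * Pr n p) = (S n p q U : ℂ) := by
  set X := B (Pr n q) U with hX
  set P := Pr n p with hP
  have h : trace (X * P * X * P) = trace ((P * X * P) * star (P * X * P)) := by
    have hs : star (P * X * P) = P * X * P := by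
      simp only [star_mul, hX, hP, Pr_star, B_star, mul_assoc]
    rw [hs]
    have : P * X * P * (P * X * P) = P * (X * (P * P) * X * P) := by simp only [mul_assoc]
    rw [this, trace_mul_comm P, hP, Pr_sq, mul_assoc _ (Pr n p) (Pr n p), Pr_sq]
  rw [h]
  simp only [S, trace, diag, mul_apply (M := P * X * P), ← hX, ← hP]
  push_cast
  refine Finset.sum_congr rfl fun i _ => Finset.sum_congr rfl fun j _ => ?_
  rw [star_apply, RCLike.star_def, Complex.mul_conj, Complex.normSq_eq_norm_sq]
  push_cast; rfl

theorem cont_T (n p q : ℕ) : Continuous (truncTraceU n p q) := by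
  have : truncTraceU n p q = fun U => (trace (Pr n p * B (Pr n q) U)).re := by
    ext U; rw [trace_PB]; simp
  rw [this]
  have hB := continuous_B (Pr n q)
  exact Complex.continuous_re.comp (by fun_prop)

theorem cont_S (n p q : ℕ) : Continuous (S n p q) := by
  have : S n p q = fun U => (trace (B (Pr n q) U * Pr n p * B (Pr n q) U * Pr n p)).re := by
    ext U; rw [trace_BPBP]; simp
  rw [this]
  have hB := continuous_B (Pr n q)
  exact Complex.continuous_re.comp (by fun_prop)

theorem real_ibp (μ : Measure (UG n)) [IsProbabilityMeasure μ] [μ.IsMulLeftInvariant]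
    (hn : 2 ≤ n) {p q : ℕ} (hp : p ≤ n) (hq : q ≤ n) (k : ℕ) :
    ∫ U, (k * (truncTraceU n p q U - (p : ℝ) * q / n) ^ (k - 1)
        * (2 * S n p q U - 2 * truncTraceU n p q U)
      + 2 * n * (truncTraceU n p q U - (p : ℝ) * q / n) ^ (k + 1)) ∂μ = 0 := by
  have h := ibp_sum μ (Pr n p) (Pr n q) ((p : ℂ) * q / n) k
  simp only [trace_BPBP, B_sq, Pr_sq, B_trace, trace_PB, Pr_trace hp, Pr_trace hq] at h
  have hn0 : (n : ℂ) ≠ 0 := by simp; omega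
  have h' : ∫ U, (((k * (truncTraceU n p q U - (p : ℝ) * q / n) ^ (k - 1)
        * (2 * S n p q U - 2 * truncTraceU n p q U)
      + 2 * n * (truncTraceU n p q U - (p : ℝ) * q / n) ^ (k + 1) : ℝ)) : ℂ) ∂μ = 0 := by
    rw [← h]
    congr 1
    ext U
    push_cast
    rw [pow_succ _ k]
    field_simp
  rw [integral_complex_ofReal] at h'
  exact_mod_cast h'

theorem bound (μ : Measure (UG n)) [IsProbabilityMeasure μ] [μ.IsMulLeftInvariant]
    (hn : 2 ≤ n) {p q : ℕ} (hp1 : 1 ≤ p) (hp : p ≤ n) (hq1 : 1 ≤ q) (hq : q ≤ n) :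
    ∫ U, (truncTraceU n p q U - (p : ℝ) * q / n) ^ 4 ∂μ ≤
          15 * p ^ 2 * q ^ 2 / (n : ℝ) ^ 4 := by
  have hT := cont_T n p q
  have hS := cont_S n p q
  have hS0 : ∀ U, 0 ≤ S n p q U := fun U => by unfold S; positivity
  have hn0 : (0 : ℝ) < n := by exact_mod_cast (by omega : 0 < n)
  have h0 := real_ibp μ hn hp hq 0
  have h1 := real_ibp μ hn hp hq 1
  have h3 := real_ibp μ hn hp hq 3
  set c : ℝ := (p : ℝ) * q / n with hc
  set f : UG n → ℝ := fun U => truncTraceU n p q U - c with hf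
  have hfc : Continuous f := by fun_prop
  have hTf : ∀ U, truncTraceU n p q U = f U + c := fun U => by simp [hf]
  simp only [hTf, add_sub_cancel_right] at h0 h1 h3 ⊢
  norm_num at h0 h1 h3
  rw [integral_const_mul] at h0
  have e0 : ∫ U, f U ∂μ = 0 := by
    rcases mul_eq_zero.mp h0 with h | h
    · exact absurd h (by positivity)
    · exact h
  have i : ∀ {g : UG n → ℝ}, Continuous g → Integrable g μ := fun h => integrable_cont μ h
  have e1 : 2 * n * ∫ U, f U ^ 2 ∂μ ≤ 2 * c := by
    have : ∫ U, (2 * n * f U ^ 2 - 2 * f U - 2 * c) ∂μ ≤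
      ∫ U, (2 * S n p q U - 2 * (f U + c) + 2 * n * f U ^ 2) ∂μ := by
      refine integral_mono (i (by fun_prop)) (i (by fun_prop)) fun U => ?_
      have := hS0 U
      dsimp only
      linarith
    rw [h1, integral_sub (i (by fun_prop)) (i (by fun_prop)),
      integral_sub (i (by fun_prop)) (i (by fun_prop)), integral_const_mul, integral_const_mul,
      e0] at this
    simp at this
    linarith
  have e3 : n * ∫ U, f U ^ 4 ∂μ ≤ (9 / n + 6 * c) * ∫ U, f U ^ 2 ∂μ := by
    have : ∫ U, (n * f U ^ 4 - (9 / n + 6 * c) * f U ^ 2) ∂μ ≤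
      ∫ U, (3 * f U ^ 2 * (2 * S n p q U - 2 * (f U + c)) + 2 * n * f U ^ 4) ∂μ := by
      refine integral_mono (i (by fun_prop)) (i (by fun_prop)) fun U => ?_
      have h := hS0 U
      dsimp only
      have a1 : 0 ≤ f U ^ 2 * S n p q U := by positivity
      have a2 : 0 ≤ f U ^ 2 * ((n * f U - 3) ^ 2 / n) := by positivity
      have a3 : f U ^ 2 * ((n * f U - 3) ^ 2 / n) = n * f U ^ 4 - 6 * f U ^ 3 + 9 / n * f U ^ 2 := by
        field_simp
        ring
      linarith
    rw [h3, integral_sub (i (by fun_prop)) (i (by fun_prop)), integral_const_mul,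
      integral_const_mul] at this
    linarith
  have hpq : (1 : ℝ) ≤ p * q := by exact_mod_cast Nat.mul_pos hp1 hq1
  have e1' : ∫ U, f U ^ 2 ∂μ ≤ p * q / n ^ 2 := by
    rw [le_div_iff₀ (by positivity)]
    have : c * n = p * q := by rw [hc]; field_simp
    nlinarith
  have hc0 : 0 ≤ c := by positivity
  have e4 : n * ∫ U, f U ^ 4 ∂μ ≤ (9 / n + 6 * c) * (p * q / n ^ 2) :=
    e3.trans (mul_le_mul_of_nonneg_left e1' (by positivity))
  have e5 : (9 / n + 6 * c) * (p * q / n ^ 2) ≤ n * (15 * p ^ 2 * q ^ 2 / (n : ℝ) ^ 4) := by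
    have l : (9 / n + 6 * c) * (p * q / n ^ 2) = (9 * (p * q) + 6 * (p * q) ^ 2) / n ^ 3 := by
      rw [hc]; field_simp
    have r : n * (15 * p ^ 2 * q ^ 2 / (n : ℝ) ^ 4) = (15 * (p * q : ℝ) ^ 2) / n ^ 3 := by
      field_simp
    rw [l, r]
    gcongr
    nlinarith
  exact le_of_mul_le_mul_left (e4.trans e5) hn0

end FMB

/-- There is a constant `C > 0` such that for every `n ≥ 2`, all
`1 ≤ p, q ≤ n` and `U` Haar distributed on `U(n)`,
`E[(T_{p,q} - pq/n)⁴] ≤ C p² q² / n⁴`. -/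
theorem fourth_moment_bound_truncTraceU :
    ∃ C : ℝ, 0 < C ∧ ∀ n : ℕ, 2 ≤ n → ∀ p q : ℕ, 1 ≤ p → p ≤ n → 1 ≤ q → q ≤ n →
      ∀ μ : Measure (Matrix.unitaryGroup (Fin n) ℂ),
        μ.IsHaarMeasure → IsProbabilityMeasure μ →
        ∫ U, (truncTraceU n p q U - (p : ℝ) * q / n) ^ 4 ∂μ ≤
          C * p ^ 2 * q ^ 2 / (n : ℝ) ^ 4 := by
  refine ⟨15, by norm_num, ?_⟩
  intro n hn p q hp1 hp hq1 hq μ hμ hμ'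
  exact FMB.bound μ hn hp1 hp hq1 hq
end
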